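/- Let (X,d) be a proper length metric space, W : X → [0,∞) continuous, and set K := √(2W). Assume: (i) Σ := {K = 0} = {W = 0} is finite and K(x) ≥ k(d(x,Σ)) for some continuous k : [0,∞) → [0,∞) with ∫_0^∞ k(t) dt = +∞; (ii) x⁻, x⁺ ∈ X satisfy W(x⁻) = W(x⁺) = 0 and the strict triangle inequality holds: for every x ∈ X \ {x⁻, x⁺} with W(x) = 0, d_K(x⁻,x⁺) < d_K(x⁻,x) + d_K(x,x⁺). Then there exists a Lipschitz curve γ : ℝ → X with γ(t) → x⁻ as t → −∞ and γ(t) → x⁺ as t → +∞ such that E_W(γ) = inf{ E_W(σ) : σ piecewise locally Lipschitz from x⁻ to x⁺ }, and moreover E_W(γ) = d_K(x⁻, x⁺). -/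

import Mathlib

open Filter Topology MeasureTheory Set
open scoped ENNReal NNReal Classical

section Defs

variable {X : Type*} [MetricSpace X]

/-- The metric derivative of the curve `γ` within the set `I` at the point `t` exists and has
value `L`, i.e. `lim_{s → t, s ∈ I} dist (γ s) (γ t) / |s - t| = L`. -/
def HasMetricDerivWithinAt (γ : ℝ → X) (I : Set ℝ) (t : ℝ) (L : ℝ) : Prop :=
  Tendsto (fun s => dist (γ s) (γ t) / |s - t|) (𝓝[I \ {t}] t) (𝓝 L)

/-- The metric derivative `|γ̇|(t)` of `γ` within `I` at `t` (junk value `0` if the defining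
limit does not exist). -/
noncomputable def metricDerivWithin (γ : ℝ → X) (I : Set ℝ) (t : ℝ) : ℝ :=
  if h : ∃ L, HasMetricDerivWithinAt γ I t L then h.choose else 0

/-- `γ` is locally Lipschitz on the set `s ⊆ ℝ`. -/
def LocallyLipschitzOnSet (γ : ℝ → X) (s : Set ℝ) : Prop :=
  ∀ t ∈ s, ∃ ε > 0, ∃ C : NNReal, LipschitzOnWith C γ (s ∩ Metric.ball t ε)

/-- `γ` is a piecewise locally Lipschitz curve on the interval `I`: it is continuous on `I`
and locally Lipschitz outside finitely many points of `I` (equivalently, there are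
`t_0 = inf I < t_1 < ⋯ < t_n = sup I` such that `γ` is locally Lipschitz on each
`I ∩ (t_i, t_(i+1))`). -/
def PiecewiseLocLipOn (γ : ℝ → X) (I : Set ℝ) : Prop :=
  ContinuousOn γ I ∧ ∃ S : Finset ℝ, LocallyLipschitzOnSet γ (I \ ↑S)

/-- The `K`-weighted length `L_K(γ) = ∫_I K (γ t) * |γ̇| t dt` of a curve `γ` defined on `I`. -/
noncomputable def KLength (K : X → ℝ) (γ : ℝ → X) (I : Set ℝ) : ℝ≥0∞ :=
  ∫⁻ t in I, ENNReal.ofReal (K (γ t) * metricDerivWithin γ I t)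

/-- The filter of approach to the left endpoint of the interval `I` (the endpoint may be
`-∞`, i.e. `I` may be unbounded below). -/
noncomputable def leftEndFilter (I : Set ℝ) : Filter ℝ :=
  if BddBelow I then 𝓝[I] (sInf I) else Filter.atBot ⊓ Filter.principal I

/-- The filter of approach to the right endpoint of the interval `I`. -/
noncomputable def rightEndFilter (I : Set ℝ) : Filter ℝ :=
  if BddAbove I then 𝓝[I] (sSup I) else Filter.atTop ⊓ Filter.principal I

/-- `γ`, defined on the nonempty interval `I`, is a path from `x` to `y`: it is continuous on
`I` and converges to `x` (resp. `y`) at the left (resp. right) endpoint of `I` (where the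
value at an infinite endpoint is understood as a limit). -/
def IsPathOn (γ : ℝ → X) (I : Set ℝ) (x y : X) : Prop :=
  I.Nonempty ∧ I.OrdConnected ∧ ContinuousOn γ I ∧
    Tendsto γ (leftEndFilter I) (𝓝 x) ∧ Tendsto γ (rightEndFilter I) (𝓝 y)

/-- The weighted (pseudo-)distance `d_K(x,y)`: the infimum of `L_K` over piecewise locally
Lipschitz paths from `x` to `y`. -/
noncomputable def dK (K : X → ℝ) (x y : X) : ℝ≥0∞ :=
  ⨅ (γ : ℝ → X) (I : Set ℝ) (_ : PiecewiseLocLipOn γ I) (_ : IsPathOn γ I x y),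
    KLength K γ I

/-- The intrinsic (geodesic) distance: the infimum of the length `L_d(γ) = eVariationOn γ I`
over all paths from `x` to `y`. -/
noncomputable def geodDist (x y : X) : ℝ≥0∞ :=
  ⨅ (γ : ℝ → X) (I : Set ℝ) (_ : IsPathOn γ I x y), eVariationOn γ I

/-- A length space: the distance coincides with the intrinsic distance. -/
def IsLengthSpace (Y : Type*) [MetricSpace Y] : Prop :=
  ∀ x y : Y, geodDist x y = edist x y

/-- `K_r(x) := inf { K z : dist x z ≤ r }`. -/
noncomputable def Kinf (K : X → ℝ) (x : X) (r : ℝ) : ℝ :=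
  sInf (K '' Metric.closedBall x r)

/-- `K^r(x) := sup { K z : dist x z ≤ r }`. -/
noncomputable def Ksup (K : X → ℝ) (x : X) (r : ℝ) : ℝ :=
  sSup (K '' Metric.closedBall x r)

/-- The energy `E_W(γ) = ∫_I (½ |γ̇|(t)² + W (γ t)) dt`. -/
noncomputable def energyW (W : X → ℝ) (γ : ℝ → X) (I : Set ℝ) : ℝ≥0∞ :=
  ∫⁻ t in I, ENNReal.ofReal ((metricDerivWithin γ I t) ^ 2 / 2 + W (γ t))

end Defs

section MetricDerivative

variable {X : Type*} [MetricSpace X]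

theorem metricDerivWithin_congr {γ γ' : ℝ → X} {I : Set ℝ} {t : ℝ} (hI : t ∈ interior I)
    (h : γ =ᶠ[𝓝 t] γ') : metricDerivWithin γ I t = metricDerivWithin γ' univ t := by
  have hfilter : 𝓝[I \ {t}] t = 𝓝[univ \ {t}] t := by
    rw [sdiff_eq, sdiff_eq]
    exact nhdsWithin_inter_of_mem (mem_nhdsWithin_of_mem_nhds (mem_interior_iff_mem_nhds.1 hI))
      |>.trans (by simp)
  have key : HasMetricDerivWithinAt γ I t = HasMetricDerivWithinAt γ' univ t := by
    funext L
    unfold HasMetricDerivWithinAt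
    rw [hfilter]
    refine propext (tendsto_congr' ?_)
    filter_upwards [mem_nhdsWithin_of_mem_nhds h] with s hs
    have hs' : γ s = γ' s := hs
    rw [hs', h.self_of_nhds]
  simp only [metricDerivWithin, key]

theorem metricDerivWithin_of_mem_interior {γ : ℝ → X} {I : Set ℝ} {t : ℝ} (hI : t ∈ interior I) :
    metricDerivWithin γ I t = metricDerivWithin γ univ t :=
  metricDerivWithin_congr hI EventuallyEq.rfl

theorem HasMetricDerivWithinAt.metricDerivWithin_eq {γ : ℝ → X} {t L : ℝ}
    (h : HasMetricDerivWithinAt γ univ t L) : metricDerivWithin γ univ t = L := by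
  have hex : ∃ L, HasMetricDerivWithinAt γ univ t L := ⟨L, h⟩
  have : (𝓝[univ \ {t}] t).NeBot := by rw [← compl_eq_univ_sdiff]; infer_instance
  rw [metricDerivWithin, dif_pos hex]
  exact tendsto_nhds_unique hex.choose_spec h

theorem metricDerivWithin_univ_nonneg (γ : ℝ → X) (t : ℝ) : 0 ≤ metricDerivWithin γ univ t := by
  by_cases hex : ∃ L, HasMetricDerivWithinAt γ univ t L
  · have : (𝓝[univ \ {t}] t).NeBot := by rw [← compl_eq_univ_sdiff]; infer_instance
    obtain ⟨L, hL⟩ := hex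
    rw [hL.metricDerivWithin_eq]
    exact ge_of_tendsto' hL fun s => by positivity
  · rw [metricDerivWithin, dif_neg hex]

theorem metricDerivWithin_univ_le {γ : ℝ → X} {t C : ℝ} (hC : 0 ≤ C)
    (h : ∃ᶠ s in 𝓝[≠] t, dist (γ s) (γ t) ≤ C * |s - t|) : metricDerivWithin γ univ t ≤ C := by
  by_cases hex : ∃ L, HasMetricDerivWithinAt γ univ t L
  · obtain ⟨L, hL⟩ := hex
    rw [hL.metricDerivWithin_eq]
    rw [HasMetricDerivWithinAt, ← compl_eq_univ_sdiff] at hL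
    refine le_of_tendsto_of_frequently hL (h.mono fun s hs => ?_)
    exact div_le_of_le_mul₀ (abs_nonneg _) hC hs
  · rw [metricDerivWithin, dif_neg hex]
    exact hC

/-- Rademacher's theorem for Lipschitz curves: the metric derivative exists almost everywhere and
is a density controlling the distance. -/
theorem LipschitzWith.exists_ae_hasMetricDeriv [TopologicalSpace.SeparableSpace X]
    {σ : ℝ → X} {C : ℝ≥0}
    (hσ : LipschitzWith C σ) :
    ∃ m : ℝ → ℝ, (∀ a b, IntervalIntegrable m volume a b) ∧
      (∀ᵐ t, HasMetricDerivWithinAt σ univ t (m t)) ∧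
      ∀ s t, s ≤ t → dist (σ s) (σ t) ≤ ∫ u in s..t, m u := by
  have hne : Nonempty X := ⟨σ 0⟩
  set f : ℕ → ℝ → ℝ := fun n t => dist (σ t) (TopologicalSpace.denseSeq X n) with hf
  have hfL : ∀ n, LipschitzWith C (f n) := fun n => by
    have h := (LipschitzWith.dist_left (TopologicalSpace.denseSeq X n)).comp hσ
    rwa [one_mul] at h
  have hbd : ∀ n t, |deriv (f n) t| ≤ C := fun n t => by
    simpa using norm_deriv_le_of_lipschitz (x₀ := t) (hfL n)
  set m : ℝ → ℝ := fun t => ⨆ n, |deriv (f n) t| with hm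
  have hbdd : ∀ t, BddAbove (range fun n => |deriv (f n) t|) := fun t =>
    ⟨C, by rintro _ ⟨n, rfl⟩; exact hbd n t⟩
  have hle : ∀ n t, |deriv (f n) t| ≤ m t := fun n t => le_ciSup (hbdd t) n
  have hm0 : ∀ t, 0 ≤ m t := fun t => (abs_nonneg _).trans (hle 0 t)
  have hmC : ∀ t, m t ≤ C := fun t => ciSup_le fun n => hbd n t
  have hmeas : Measurable m :=
    Measurable.iSup fun n => by
      have h := measurable_deriv (f n)
      exact h.norm
  have hloc : LocallyIntegrable m volume := by
    have hc : LocallyIntegrable (fun _ : ℝ => (C : ℝ)) volume := locallyIntegrable_const _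
    refine hc.mono hmeas.aestronglyMeasurable (Eventually.of_forall fun t => ?_)
    rw [Real.norm_of_nonneg (hm0 t)]
    exact (hmC t).trans (le_abs_self _)
  have hInt : ∀ a b, IntervalIntegrable m volume a b := fun a b =>
    (hloc.integrableOn_isCompact isCompact_uIcc).intervalIntegrable
  have hdist : ∀ s t, s ≤ t → dist (σ s) (σ t) ≤ ∫ u in s..t, m u := by
    intro s t hst
    refine le_of_forall_pos_le_add fun η hη => ?_
    obtain ⟨n, hn⟩ := (TopologicalSpace.denseRange_denseSeq X).exists_dist_lt (σ s) (half_pos hη)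
    have hac : AbsolutelyContinuousOnInterval (f n) s t :=
      ((hfL n).lipschitzOnWith (s := uIcc s t)).absolutelyContinuousOnInterval
    have h1 : f n t - f n s ≤ ∫ u in s..t, m u := by
      rw [← hac.integral_deriv_eq_sub]
      exact intervalIntegral.integral_mono_on hst hac.intervalIntegrable_deriv (hInt s t)
        fun u _ => (le_abs_self _).trans (hle n u)
    have h2 : dist (σ s) (σ t) ≤ f n s + f n t := dist_triangle_right _ _ _
    have h3 : f n s < η / 2 := hn
    linarith
  refine ⟨m, hInt, ?_, hdist⟩
  have hdiff : ∀ᵐ t, ∀ n, DifferentiableAt ℝ (f n) t :=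
    ae_all_iff.2 fun n => (hfL n).ae_differentiableAt_real
  filter_upwards [hdiff, LocallyIntegrable.ae_hasDerivAt_integral hloc] with t hdt hFt
  have hF := hFt 0
  set F : ℝ → ℝ := fun x => ∫ u in (0 : ℝ)..x, m u with hFdef
  have hdF : ∀ s, dist (σ s) (σ t) ≤ |F s - F t| := by
    intro s
    have hsub : ∀ a b, ∫ u in a..b, m u = F b - F a := fun a b =>
      (intervalIntegral.integral_interval_sub_left (hInt 0 b) (hInt 0 a)).symm
    rcases le_total s t with h | h
    · rw [abs_sub_comm]
      exact (hdist s t h).trans ((hsub s t).le.trans (le_abs_self _))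
    · rw [dist_comm]
      exact (hdist t s h).trans ((hsub t s).le.trans (le_abs_self _))
  have habs : ∀ {g : ℝ → ℝ} {g' : ℝ}, HasDerivAt g g' t →
      Tendsto (fun s => |g s - g t| / |s - t|) (𝓝[≠] t) (𝓝 |g'|) := by
    intro g g' hg
    have h := (hasDerivAt_iff_tendsto_slope.1 hg).abs
    refine h.congr fun s => ?_
    rw [slope_def_field, abs_div]
  rw [HasMetricDerivWithinAt, ← compl_eq_univ_sdiff]
  refine tendsto_order.2 ⟨fun c hc => ?_, fun c hc => ?_⟩
  · obtain ⟨n, hn⟩ := exists_lt_of_lt_ciSup hc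
    filter_upwards [(tendsto_order.1 (habs (hdt n).hasDerivAt)).1 c hn] with s hs
    refine hs.trans_le (div_le_div_of_nonneg_right ?_ (abs_nonneg _))
    exact abs_dist_sub_le _ _ _
  · have h := habs hF
    rw [abs_of_nonneg (hm0 t)] at h
    filter_upwards [(tendsto_order.1 h).2 c hc] with s hs
    exact (div_le_div_of_nonneg_right (hdF s) (abs_nonneg _)).trans_lt hs

theorem LipschitzOnWith.ofReal_dist_le_lintegral_metricDeriv [TopologicalSpace.SeparableSpace X]
    {σ : ℝ → X} {C : ℝ≥0} {a b : ℝ} (hσ : LipschitzOnWith C σ (Icc a b)) (hab : a ≤ b) :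
    ENNReal.ofReal (dist (σ a) (σ b)) ≤
      ∫⁻ t in Ioo a b, ENNReal.ofReal (metricDerivWithin σ univ t) := by
  set τ : ℝ → X := fun t => σ (projIcc a b hab t) with hτ
  have hτL : LipschitzWith C τ := by
    intro s t
    calc edist (τ s) (τ t) ≤ C * edist (projIcc a b hab s : ℝ) (projIcc a b hab t) :=
          hσ (projIcc a b hab s).2 (projIcc a b hab t).2
      _ ≤ C * edist s t := by
          gcongr
          have h := (LipschitzWith.projIcc hab) s t
          rwa [ENNReal.coe_one, one_mul] at h
  obtain ⟨m, hInt, hae, hd⟩ := hτL.exists_ae_hasMetricDeriv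
  have h1 := hd a b hab
  have hτa : τ a = σ a := by simp [hτ]
  have hτb : τ b = σ b := by simp [hτ]
  rw [hτa, hτb, intervalIntegral.integral_of_le hab] at h1
  have hmeq : ∀ᵐ t ∂(volume.restrict (Ioc a b)), m t = metricDerivWithin σ univ t := by
    rw [← restrict_Ioo_eq_restrict_Ioc]
    filter_upwards [ae_restrict_of_ae hae, ae_restrict_mem measurableSet_Ioo] with t ht htI
    rw [← ht.metricDerivWithin_eq]
    refine metricDerivWithin_congr (by simp) ?_
    filter_upwards [Ioo_mem_nhds htI.1 htI.2] with s hs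
    simp [hτ, projIcc_of_mem hab (Ioo_subset_Icc_self hs)]
  rw [integral_congr_ae hmeq] at h1
  have hI : Integrable (fun t => metricDerivWithin σ univ t) (volume.restrict (Ioc a b)) :=
    ((hInt a b).1).congr hmeq
  calc ENNReal.ofReal (dist (σ a) (σ b))
      ≤ ENNReal.ofReal (∫ t in Ioc a b, metricDerivWithin σ univ t) := ENNReal.ofReal_le_ofReal h1
    _ = ∫⁻ t in Ioc a b, ENNReal.ofReal (metricDerivWithin σ univ t) :=
        ofReal_integral_eq_lintegral_ofReal hI
          (Eventually.of_forall fun t => metricDerivWithin_univ_nonneg σ t)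
    _ = _ := by rw [restrict_Ioo_eq_restrict_Ioc]

theorem LipschitzOnWith.metricDerivWithin_le {σ : ℝ → X} {C : ℝ≥0} {s : Set ℝ} {t : ℝ}
    (hσ : LipschitzOnWith C σ s) (ht : s ∈ 𝓝 t) : metricDerivWithin σ univ t ≤ C := by
  refine metricDerivWithin_univ_le C.2 (Eventually.frequently ?_)
  filter_upwards [mem_nhdsWithin_of_mem_nhds ht] with u hu
  simpa [Real.dist_eq] using hσ.dist_le_mul u hu t (mem_of_mem_nhds ht)

end MetricDerivative

section Chains

variable {X : Type*} [MetricSpace X] {K : X → ℝ}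

/-- `ChainCost K ε x y c` means that some finite chain of points from `x` to `y` with consecutive
distances less than `ε` has total cost `∑ K(xᵢ) d(xᵢ, xᵢ₊₁) = c`. -/
inductive ChainCost (K : X → ℝ) (ε : ℝ) : X → X → ℝ → Prop
  | nil (x : X) : ChainCost K ε x x 0
  | cons {x y z : X} {c : ℝ} (h : dist x y < ε) (hc : ChainCost K ε y z c) :
      ChainCost K ε x z (K x * dist x y + c)

theorem ChainCost.trans {ε : ℝ} {x y z : X} {c c' : ℝ} (h : ChainCost K ε x y c)
    (h' : ChainCost K ε y z c') : ChainCost K ε x z (c + c') := by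
  induction h with
  | nil x => simpa using h'
  | cons hd _ ih => rw [add_assoc]; exact .cons hd (ih h')

theorem ChainCost.single {ε : ℝ} {x y : X} (h : dist x y < ε) :
    ChainCost K ε x y (K x * dist x y) := by
  simpa using ChainCost.cons h (.nil y)

theorem ChainCost.mono {ε ε' : ℝ} (hε : ε ≤ ε') {x y : X} {c : ℝ} (h : ChainCost K ε x y c) :
    ChainCost K ε' x y c := by
  induction h with
  | nil x => exact .nil x
  | cons hd _ ih => exact .cons (hd.trans_le hε) ih

theorem ChainCost.nonneg (hK : ∀ x, 0 ≤ K x) {ε : ℝ} {x y : X} {c : ℝ}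
    (h : ChainCost K ε x y c) : 0 ≤ c := by
  induction h with
  | nil x => exact le_rfl
  | cons hd _ ih => exact add_nonneg (mul_nonneg (hK _) dist_nonneg) ih

theorem ChainCost.abs_sub_le {ε : ℝ} {f : X → ℝ}
    (hf : ∀ u v, dist u v < ε → |f u - f v| ≤ K u * dist u v) {x y : X} {c : ℝ}
    (h : ChainCost K ε x y c) : |f x - f y| ≤ c := by
  induction h with
  | nil x => simp
  | cons hd _ ih => exact (_root_.abs_sub_le _ _ _).trans (add_le_add (hf _ _ hd) ih)

/-- The chain distance from `x` to `y`, obtained from chains of arbitrarily small mesh,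
is at most `c`. -/
def ChainDistLE (K : X → ℝ) (x y : X) (c : ℝ) : Prop :=
  ∀ ε > 0, ∀ η > 0, ∃ c' < c + η, ChainCost K ε x y c'

theorem ChainDistLE.trans {x y z : X} {c c' : ℝ} (h : ChainDistLE K x y c)
    (h' : ChainDistLE K y z c') : ChainDistLE K x z (c + c') := by
  intro ε hε η hη
  obtain ⟨a, ha, hca⟩ := h ε hε (η / 2) (half_pos hη)
  obtain ⟨b, hb, hcb⟩ := h' ε hε (η / 2) (half_pos hη)
  exact ⟨a + b, by linarith, hca.trans hcb⟩

theorem ChainDistLE.mono {x y : X} {c c' : ℝ} (h : ChainDistLE K x y c) (hc : c ≤ c') :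
    ChainDistLE K x y c' := by
  intro ε hε η hη
  obtain ⟨a, ha, hca⟩ := h ε hε η hη
  exact ⟨a, by linarith, hca⟩

theorem ChainDistLE.nonneg (hK : ∀ x, 0 ≤ K x) {x y : X} {c : ℝ} (h : ChainDistLE K x y c) :
    0 ≤ c := by
  refine le_of_forall_pos_le_add fun η hη => ?_
  obtain ⟨a, ha, hca⟩ := h 1 one_pos η hη
  exact (hca.nonneg hK).trans ha.le

theorem ChainDistLE.abs_sub_le {ε : ℝ} (hε : 0 < ε) {f : X → ℝ}
    (hf : ∀ u v, dist u v < ε → |f u - f v| ≤ K u * dist u v) {x y : X} {c : ℝ}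
    (h : ChainDistLE K x y c) : |f x - f y| ≤ c := by
  refine le_of_forall_pos_le_add fun η hη => ?_
  obtain ⟨a, ha, hca⟩ := h ε hε η hη
  exact (hca.abs_sub_le hf).trans ha.le

theorem abs_clamp_sub_clamp_le (a b r₁ r₂ : ℝ) :
    |max r₁ (min r₂ a) - max r₁ (min r₂ b)| ≤ |a - b| := by
  refine (abs_max_sub_max_le_max _ _ _ _).trans ?_
  simp only [sub_self, abs_zero]
  refine max_le (abs_nonneg _) ((abs_min_sub_min_le_max _ _ _ _).trans ?_)
  simp

/-- If `K ≥ c` on an annulus around `x`, then crossing the annulus costs at least `c` times its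
width. -/
theorem ChainDistLE.mul_abs_clamp_le (hK : ∀ x, 0 ≤ K x) {x : X} {c r₁ r₂ ε : ℝ} (hε : 0 < ε)
    (hc : 0 ≤ c)
    (h : ∀ u, r₁ - ε ≤ dist x u → dist x u ≤ r₂ + ε → c ≤ K u) {y z : X} {e : ℝ}
    (hyz : ChainDistLE K y z e) :
    c * |max r₁ (min r₂ (dist x y)) - max r₁ (min r₂ (dist x z))| ≤ e := by
  have key := hyz.abs_sub_le (f := fun u => c * max r₁ (min r₂ (dist x u))) hε ?_
  · simpa only [← mul_sub, abs_mul, abs_of_nonneg hc] using key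
  intro u v huv
  simp only [← mul_sub, abs_mul, abs_of_nonneg hc]
  have hd : |dist x u - dist x v| ≤ dist u v := by
    rw [dist_comm x u, dist_comm x v]; exact abs_dist_sub_le _ _ _
  have hd' := abs_le.1 hd
  by_cases h1 : r₁ - ε ≤ dist x u
  · by_cases h2 : dist x u ≤ r₂ + ε
    · exact mul_le_mul (h u h1 h2) ((abs_clamp_sub_clamp_le _ _ _ _).trans hd) (abs_nonneg _)
        (hK u)
    · have h3 : r₂ ≤ dist x u := by linarith
      have h4 : r₂ ≤ dist x v := by linarith
      rw [min_eq_left h3, min_eq_left h4, sub_self, abs_zero, mul_zero]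
      exact mul_nonneg (hK u) dist_nonneg
  · have h3 : dist x u ≤ r₁ := by linarith
    have h4 : dist x v ≤ r₁ := by linarith
    rw [max_eq_left ((min_le_right _ _).trans h3), max_eq_left ((min_le_right _ _).trans h4),
      sub_self, abs_zero, mul_zero]
    exact mul_nonneg (hK u) dist_nonneg

theorem ChainDistLE.mul_min_dist_le (hK : ∀ x, 0 ≤ K x) {x y : X} {c r e : ℝ} (hr : 0 < r)
    (hc : 0 ≤ c) (h : ∀ u, dist x u ≤ 2 * r → c ≤ K u)
    (hxy : ChainDistLE K x y e ∨ ChainDistLE K y x e) : c * min r (dist x y) ≤ e := by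
  have hmin : 0 ≤ min r (dist x y) := le_min hr.le dist_nonneg
  have h' : ∀ u, 0 - r ≤ dist x u → dist x u ≤ r + r → c ≤ K u := fun u _ hu =>
    h u (by linarith)
  have key : c * |max 0 (min r (dist x x)) - max 0 (min r (dist x y))| ≤ e := by
    rcases hxy with hxy | hxy
    · exact hxy.mul_abs_clamp_le hK hr hc h'
    · rw [abs_sub_comm]
      exact hxy.mul_abs_clamp_le hK hr hc h'
  rwa [dist_self, min_eq_right hr.le, max_self, max_eq_right hmin, zero_sub, abs_neg,
    abs_of_nonneg hmin] at key

/-- The topology of the chain distance is finer than the original one. -/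
theorem exists_pos_dist_lt_of_chainDistLE [ProperSpace X] (hKc : Continuous K)
    (hK : ∀ x, 0 ≤ K x) (hfin : {x | K x = 0}.Finite) (x : X) {ρ : ℝ} (hρ : 0 < ρ) :
    ∃ e₀ > 0, ∀ y e, e < e₀ → (ChainDistLE K x y e ∨ ChainDistLE K y x e) → dist x y < ρ := by
  obtain ⟨r₀, hr₀, hball⟩ : ∃ r₀ > 0, ∀ u, dist x u < r₀ → K u = 0 → u = x := by
    have hopen : ({u | K u = 0} \ {x})ᶜ ∈ 𝓝 x :=
      (hfin.subset sdiff_subset).isClosed.isOpen_compl.mem_nhds (by simp)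
    obtain ⟨r₀, hr₀, h⟩ := Metric.mem_nhds_iff.1 hopen
    refine ⟨r₀, hr₀, fun u hu hKu => ?_⟩
    by_contra hne
    exact h (by rwa [Metric.mem_ball, dist_comm]) ⟨hKu, hne⟩
  set r := min r₀ ρ with hr
  have hr0 : 0 < r := lt_min hr₀ hρ
  have hcomp : IsCompact {u | r / 8 ≤ dist x u ∧ dist x u ≤ r / 2} := by
    refine (isCompact_closedBall x (r / 2)).of_isClosed_subset ?_ fun u hu => ?_
    · exact (isClosed_le continuous_const (continuous_const.dist continuous_id)).inter
        (isClosed_le (continuous_const.dist continuous_id) continuous_const)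
    · rw [Metric.mem_closedBall, dist_comm]; exact hu.2
  obtain ⟨c, hc0, hc⟩ := hcomp.exists_forall_le' (a := 0) hKc.continuousOn (fun u hu => by
    refine lt_of_le_of_ne (hK u) fun h0 => ?_
    have hux := hball u (lt_of_le_of_lt hu.2 (by have := min_le_left r₀ ρ; linarith)) h0.symm
    have := hu.1
    rw [hux, dist_self] at this
    linarith)
  refine ⟨c * (r / 8), by positivity, fun y e he hxy => ?_⟩
  by_contra hge
  have hge' : r ≤ dist x y := (min_le_right _ _).trans (not_lt.1 hge)
  have h' : ∀ u, r / 4 - r / 8 ≤ dist x u → dist x u ≤ 3 * r / 8 + r / 8 → c ≤ K u :=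
    fun u h1 h2 => hc u ⟨by linarith, by linarith⟩
  have key : c * |max (r / 4) (min (3 * r / 8) (dist x x)) -
      max (r / 4) (min (3 * r / 8) (dist x y))| ≤ e := by
    rcases hxy with hxy | hxy
    · exact hxy.mul_abs_clamp_le hK (by positivity) hc0.le h'
    · rw [abs_sub_comm]
      exact hxy.mul_abs_clamp_le hK (by positivity) hc0.le h'
  rw [dist_self, min_eq_right (by positivity), max_eq_left (by positivity),
    min_eq_left (by linarith), max_eq_right (by linarith), abs_of_nonpos (by linarith)] at key
  have : -(r / 4 - 3 * r / 8) = r / 8 := by ring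
  rw [this] at key
  linarith

theorem eq_of_chainDistLE_zero [ProperSpace X] (hKc : Continuous K)
    (hK : ∀ x, 0 ≤ K x) (hfin : {x | K x = 0}.Finite) {x y : X} (h : ChainDistLE K x y 0) :
    x = y := by
  refine eq_of_forall_dist_le fun ρ hρ => ?_
  obtain ⟨e₀, he₀, H⟩ := exists_pos_dist_lt_of_chainDistLE hKc hK hfin x hρ
  exact (H y 0 he₀ (.inl h)).le

theorem exists_lt_integral_of_lintegral_eq_top {k : ℝ → ℝ} (hk : Continuous k)
    (hk0 : ∀ t, 0 ≤ k t) (hdiv : ∫⁻ t in Ioi (0 : ℝ), ENNReal.ofReal (k t) = ⊤) (B : ℝ) :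
    ∃ R > 0, B < ∫ t in (0 : ℝ)..R, k t := by
  have hU : ⋃ n : ℕ, Ioc (0 : ℝ) n = Ioi 0 := by
    ext t
    simp only [mem_iUnion, mem_Ioc, mem_Ioi]
    exact ⟨fun ⟨n, h⟩ => h.1, fun h => ⟨_, h, Nat.le_ceil t⟩⟩
  have hmono : Monotone fun n : ℕ => Ioc (0 : ℝ) n := fun m n hmn =>
    Ioc_subset_Ioc_right (by exact_mod_cast hmn)
  have ht := tendsto_measure_iUnion_atTop (μ := volume.withDensity fun t => ENNReal.ofReal (k t))
    hmono
  rw [hU, withDensity_apply _ measurableSet_Ioi, hdiv] at ht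
  obtain ⟨n, hn, hn1⟩ :=
    ((tendsto_order.1 ht).1 (ENNReal.ofReal B) ENNReal.ofReal_lt_top |>.and
      (eventually_gt_atTop 0)).exists
  refine ⟨n, by exact_mod_cast hn1, ?_⟩
  simp only [Function.comp, withDensity_apply _ measurableSet_Ioc] at hn
  rw [← ofReal_integral_eq_lintegral_ofReal hk.integrableOn_Ioc
    (Eventually.of_forall hk0), ← intervalIntegral.integral_of_le (by positivity)] at hn
  exact lt_of_not_ge fun h => not_le.2 hn (ENNReal.ofReal_le_ofReal h)

/-- Chains of bounded cost issued from a zero of `K` stay in a bounded set. -/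
theorem exists_dist_le_of_chainCost {k : ℝ → ℝ} (hk : Continuous k) (hk0 : ∀ t, 0 ≤ k t)
    (hdiv : ∫⁻ t in Ioi (0 : ℝ), ENNReal.ofReal (k t) = ⊤) {S : Set X} (hS : S.Finite)
    (hlow : ∀ x, k (Metric.infDist x S) ≤ K x) {x₀ : X} (hx₀ : x₀ ∈ S) (B : ℝ) :
    ∃ ε₀ > 0, ∃ R, ∀ z c, c ≤ B → ChainCost K ε₀ x₀ z c → dist x₀ z ≤ R := by
  obtain ⟨R, hR, hBR⟩ := exists_lt_integral_of_lintegral_eq_top hk hk0 hdiv (B + 1)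
  have huc := (isCompact_Icc (a := (0 : ℝ)) (b := R + 1)).uniformContinuousOn_of_continuous
    hk.continuousOn
  obtain ⟨δ, hδ, hmod⟩ := Metric.uniformContinuousOn_iff.1 huc (1 / R) (by positivity)
  set ε₀ := min δ 1 with hε₀
  set q : ℝ → ℝ := fun t => max (k t - 1 / R) 0 with hq
  have hqc : Continuous q := by fun_prop
  have hq0 : ∀ t, 0 ≤ q t := fun t => le_max_right _ _
  set r : X → ℝ := fun x => Metric.infDist x S with hr
  have hr0 : ∀ x, 0 ≤ r x := fun x => Metric.infDist_nonneg
  set h : X → ℝ := fun x => ∫ t in (0 : ℝ)..(min (r x) R), q t with hh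
  have hInt : ∀ a b, IntervalIntegrable q volume a b := fun a b => hqc.intervalIntegrable a b
  have hslope : ∀ u v, dist u v < ε₀ → |h u - h v| ≤ K u * dist u v := by
    intro u v huv
    have hruv : |r u - r v| ≤ dist u v := by
      simpa [Real.dist_eq] using (Metric.lipschitz_infDist_pt S).dist_le_mul u v
    have hKu : 0 ≤ K u := (hk0 _).trans (hlow u)
    rw [hh]
    simp only
    rw [intervalIntegral.integral_interval_sub_left (hInt _ _) (hInt _ _), ← Real.norm_eq_abs]
    refine (intervalIntegral.norm_integral_le_of_norm_le_const (C := K u) fun t ht => ?_).trans ?_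
    · rw [Real.norm_of_nonneg (hq0 t)]
      have hδ1 : ε₀ ≤ δ := min_le_left _ _
      have hδ2 : ε₀ ≤ 1 := min_le_right _ _
      have hru := hr0 u
      have hrv := hr0 v
      have hfacts : 0 ≤ t ∧ t ≤ R ∧ |t - r u| ≤ |r u - r v| := by
        rw [mem_uIoc] at ht
        rcases le_total (r u) R with h1 | h1 <;> rcases le_total (r v) R with h2 | h2 <;>
          simp only [h1, h2, min_eq_left, min_eq_right] at ht <;>
          rcases ht with ht | ht <;> refine ⟨by linarith, by linarith, ?_⟩ <;>
          rw [abs_le] <;> constructor <;>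
          cases abs_cases (r u - r v) <;> linarith
      obtain ⟨ht0, htR, htu⟩ := hfacts
      have htu' : |t - r u| < ε₀ := (htu.trans hruv).trans_lt huv
      have hab := abs_lt.1 htu'
      have hclose := hmod t ⟨ht0, by linarith⟩ (r u) ⟨hru, by linarith⟩
        (by rw [Real.dist_eq]; exact htu'.trans_le hδ1)
      rw [Real.dist_eq] at hclose
      have hlu : k (r u) ≤ K u := hlow u
      refine max_le ?_ hKu
      linarith [(abs_lt.1 hclose).2]
    · refine mul_le_mul_of_nonneg_left (le_trans ?_ hruv) hKu
      refine (abs_min_sub_min_le_max _ _ _ _).trans ?_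
      simp
  obtain ⟨R', hR'⟩ := hS.isBounded.subset_closedBall x₀
  refine ⟨ε₀, lt_min hδ one_pos, R' + R, fun z c hc hchain => ?_⟩
  have hbar := hchain.abs_sub_le hslope
  have hx0 : r x₀ = 0 := Metric.infDist_zero_of_mem hx₀
  have hhx0 : h x₀ = 0 := by simp [hh, hx0, hR.le]
  rw [hhx0, zero_sub, abs_neg] at hbar
  have hrz : r z < R := by
    by_contra hge
    have hhz : h z = ∫ t in (0 : ℝ)..R, q t := by
      rw [hh]; simp only; rw [min_eq_right (not_lt.1 hge)]
    have hle : (∫ t in (0 : ℝ)..R, k t) - 1 ≤ ∫ t in (0 : ℝ)..R, q t := by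
      have h1 : ∫ t in (0 : ℝ)..R, (k t - 1 / R) = (∫ t in (0 : ℝ)..R, k t) - 1 := by
        rw [intervalIntegral.integral_sub (hk.intervalIntegrable _ _)
          (continuous_const.intervalIntegrable _ _)]
        simp [hR.ne']
      rw [← h1]
      exact intervalIntegral.integral_mono_on hR.le
        ((hk.sub continuous_const).intervalIntegrable _ _) (hInt _ _) fun t _ => le_max_left _ _
    have := le_abs_self (h z)
    linarith
  obtain ⟨p, hp, hzp⟩ := (Metric.infDist_lt_iff ⟨x₀, hx₀⟩).1 hrz
  have h1 := hR' hp
  rw [Metric.mem_closedBall] at h1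
  calc dist x₀ z ≤ dist p x₀ + dist z p := by
        rw [dist_comm p, dist_comm z]; exact dist_triangle _ _ _
    _ ≤ _ := by linarith

end Chains

section PathsToChains

variable {X : Type*} [MetricSpace X] {K : X → ℝ}

theorem exists_chainCost_le_of_dist_lt (hKc : Continuous K) (hK : ∀ x, 0 ≤ K x) (y : X) {ε η : ℝ}
    (hε : 0 < ε) (hη : 0 < η) :
    ∃ δ > 0, ∀ u, dist u y < δ →
      (∃ c ≤ η, ChainCost K ε u y c) ∧ ∃ c ≤ η, ChainCost K ε y u c := by
  obtain ⟨δ₁, hδ₁, h1⟩ := Metric.continuous_iff.1 hKc y 1 one_pos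
  have hpos : 0 < K y + 1 := by linarith [hK y]
  refine ⟨min δ₁ (min ε (η / (K y + 1))), by positivity, fun u hu => ?_⟩
  have hu1 : dist u y < δ₁ := hu.trans_le (min_le_left _ _)
  have hu2 : dist u y < ε := hu.trans_le ((min_le_right _ _).trans (min_le_left _ _))
  have hu3 : dist u y < η / (K y + 1) := hu.trans_le ((min_le_right _ _).trans (min_le_right _ _))
  have hKu : K u ≤ K y + 1 := by
    have := h1 u hu1
    rw [Real.dist_eq] at this
    linarith [(abs_lt.1 this).2]
  have hcost : (K y + 1) * dist u y ≤ η := by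
    rw [lt_div_iff₀ hpos] at hu3
    linarith
  refine ⟨⟨_, ?_, .single hu2⟩, ⟨_, ?_, .single (dist_comm u y ▸ hu2)⟩⟩
  · exact (mul_le_mul_of_nonneg_right hKu dist_nonneg).trans hcost
  · rw [dist_comm]
    exact (mul_le_mul_of_nonneg_right (by linarith) dist_nonneg).trans hcost

/-- Sampling a curve at a fine uniform partition gives a chain whose cost is controlled by any
superadditive interval function dominating the individual steps. -/
theorem exists_chainCost_le_of_superadditive {σ : ℝ → X} {a b ε δ : ℝ} (hab : a ≤ b) (hδ : 0 < δ)
    {G : ℝ → ℝ → ℝ≥0∞} (hG : ∀ r s t, r ≤ s → s ≤ t → G r s + G s t ≤ G r t)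
    (hstep : ∀ s ∈ Icc a b, ∀ t ∈ Icc a b, s ≤ t → t - s < δ →
      dist (σ s) (σ t) < ε ∧ ENNReal.ofReal (K (σ s) * dist (σ s) (σ t)) ≤ G s t) :
    ∃ c, ChainCost K ε (σ a) (σ b) c ∧ ENNReal.ofReal c ≤ G a b := by
  obtain ⟨N, hN⟩ := exists_nat_gt ((b - a) / δ)
  have hN0 : (0 : ℝ) < N := lt_of_le_of_lt (div_nonneg (by linarith) hδ.le) hN
  set h := (b - a) / N with hh
  have hh0 : 0 ≤ h := div_nonneg (by linarith) hN0.le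
  have hhδ : h < δ := by
    rw [hh, div_lt_iff₀ hN0]
    rw [div_lt_iff₀ hδ] at hN
    linarith
  have hNh : N * h = b - a := by rw [hh]; field_simp
  have key : ∀ n : ℕ, n ≤ N →
      ∃ c, ChainCost K ε (σ a) (σ (a + n * h)) c ∧ ENNReal.ofReal c ≤ G a (a + n * h) := by
    intro n
    induction n with
    | zero => intro _; exact ⟨0, by simpa using ChainCost.nil (σ a), by simp⟩
    | succ n ih =>
      intro hn
      obtain ⟨c, hc, hcG⟩ := ih (by omega)
      have hnN : ((n : ℝ) + 1) ≤ N := by exact_mod_cast hn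
      have hle : ((n : ℝ) + 1) * h ≤ b - a := hNh ▸ mul_le_mul_of_nonneg_right hnN hh0
      have hnh : 0 ≤ (n : ℝ) * h := by positivity
      obtain ⟨h1, h2⟩ := hstep (a + n * h) ⟨by linarith, by linarith⟩
        (a + (n + 1 : ℕ) * h) (by push_cast; constructor <;> linarith)
        (by push_cast; linarith) (by push_cast; linarith)
      refine ⟨_, hc.trans (.single h1), ENNReal.ofReal_add_le.trans ?_⟩
      exact (add_le_add hcG h2).trans (hG _ _ _ (by linarith) (by push_cast; linarith))
  obtain ⟨c, hc, hcG⟩ := key N le_rfl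
  have hb : a + N * h = b := by rw [hNh]; ring
  rw [hb] at hc hcG
  exact ⟨c, hc, hcG⟩

theorem LipschitzOnWith.exists_chainCost_le [TopologicalSpace.SeparableSpace X]
    (hKc : Continuous K) (hK : ∀ x, 0 ≤ K x) {σ : ℝ → X} {C : ℝ≥0} {a b : ℝ} (hab : a ≤ b)
    (hσ : LipschitzOnWith C σ (Icc a b)) {ε η : ℝ} (hε : 0 < ε) (hη : 0 < η) :
    ∃ c, ChainCost K ε (σ a) (σ b) c ∧ ENNReal.ofReal c ≤
      (∫⁻ t in Ioo a b, ENNReal.ofReal (K (σ t) * metricDerivWithin σ univ t)) +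
        ENNReal.ofReal η := by
  have hba : 0 ≤ b - a := by linarith
  set η' := η / (C * (b - a) + 1) with hη'
  have hden : 0 < C * (b - a) + 1 := by positivity
  have hη'0 : 0 < η' := by positivity
  have hcont : ContinuousOn σ (Icc a b) := hσ.continuousOn
  obtain ⟨δ₁, hδ₁, h1⟩ := Metric.uniformContinuousOn_iff.1
    (isCompact_Icc.uniformContinuousOn_of_continuous hcont) ε hε
  obtain ⟨δ₂, hδ₂, h2⟩ := Metric.uniformContinuousOn_iff.1
    (isCompact_Icc.uniformContinuousOn_of_continuous (hKc.comp_continuousOn hcont)) η' hη'0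
  set g : ℝ → ℝ≥0∞ := fun t => ENNReal.ofReal (K (σ t) * metricDerivWithin σ univ t) +
    ENNReal.ofReal (η' * C) with hg
  obtain ⟨c, hc, hcG⟩ : ∃ c, ChainCost K ε (σ a) (σ b) c ∧
      ENNReal.ofReal c ≤ ∫⁻ u in Ioo a b, g u := by
    refine exists_chainCost_le_of_superadditive hab (lt_min hδ₁ hδ₂)
      (G := fun s t => ∫⁻ u in Ioo s t, g u) ?_ ?_
    · intro r s t hrs hst
      rw [← lintegral_union measurableSet_Ioo]
      · exact lintegral_mono_set
          (union_subset (Ioo_subset_Ioo_right hst) (Ioo_subset_Ioo_left hrs))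
      · exact Set.disjoint_left.2 fun u hu hu' => absurd hu.2 (not_lt.2 hu'.1.le)
    · intro s hs t ht hst hd
      have hsub : Icc s t ⊆ Icc a b := Icc_subset_Icc hs.1 ht.2
      have habs : ∀ u ∈ Icc s t, dist s u < min δ₁ δ₂ := fun u hu => by
        rw [Real.dist_eq, abs_lt]; constructor <;> linarith [hu.1, hu.2]
      refine ⟨h1 s hs t ht ((habs t ⟨hst, le_rfl⟩).trans_le (min_le_left _ _)), ?_⟩
      rw [ENNReal.ofReal_mul (hK _)]
      calc ENNReal.ofReal (K (σ s)) * ENNReal.ofReal (dist (σ s) (σ t))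
          ≤ ENNReal.ofReal (K (σ s)) *
            ∫⁻ u in Ioo s t, ENNReal.ofReal (metricDerivWithin σ univ u) := by
            gcongr
            exact (hσ.mono hsub).ofReal_dist_le_lintegral_metricDeriv hst
        _ = ∫⁻ u in Ioo s t,
            ENNReal.ofReal (K (σ s)) * ENNReal.ofReal (metricDerivWithin σ univ u) :=
            (lintegral_const_mul' _ _ ENNReal.ofReal_ne_top).symm
        _ ≤ ∫⁻ u in Ioo s t, g u := by
            refine setLIntegral_mono' measurableSet_Ioo fun u hu => ?_
            have hu' : u ∈ Icc a b := hsub (Ioo_subset_Icc_self hu)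
            have hm0 := metricDerivWithin_univ_nonneg σ u
            have hmC : metricDerivWithin σ univ u ≤ C :=
              hσ.metricDerivWithin_le (Icc_mem_nhds (hs.1.trans_lt hu.1) (hu.2.trans_le ht.2))
            have hKd := h2 s hs u hu'
              ((habs u (Ioo_subset_Icc_self hu)).trans_le (min_le_right _ _))
            rw [Real.dist_eq] at hKd
            have hKs : K (σ s) ≤ K (σ u) + η' := by
              have := (abs_lt.1 hKd).2
              simp only [Function.comp] at this
              linarith
            rw [← ENNReal.ofReal_mul (hK _)]
            simp only [hg]
            rw [← ENNReal.ofReal_add (mul_nonneg (hK _) hm0) (by positivity)]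
            refine ENNReal.ofReal_le_ofReal ?_
            calc K (σ s) * metricDerivWithin σ univ u
                ≤ (K (σ u) + η') * metricDerivWithin σ univ u :=
                  mul_le_mul_of_nonneg_right hKs hm0
              _ ≤ _ := by
                  rw [add_mul]
                  gcongr
  refine ⟨c, hc, hcG.trans ?_⟩
  simp only [hg]
  rw [lintegral_add_right _ measurable_const]
  gcongr
  rw [setLIntegral_const, Real.volume_Ioo, ← ENNReal.ofReal_mul (by positivity)]
  refine ENNReal.ofReal_le_ofReal ?_
  rw [hη', div_mul_eq_mul_div, div_mul_eq_mul_div, div_le_iff₀ hden]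
  nlinarith

theorem LocallyLipschitzOnSet.mono {γ : ℝ → X} {s t : Set ℝ} (h : LocallyLipschitzOnSet γ t)
    (hst : s ⊆ t) : LocallyLipschitzOnSet γ s := fun u hu => by
  obtain ⟨ε, hε, C, hC⟩ := h u (hst hu)
  exact ⟨ε, hε, C, hC.mono (inter_subset_inter_left _ hst)⟩

theorem LocallyLipschitzOnSet.exists_lipschitzOnWith {γ : ℝ → X} {s : Set ℝ} (hs : IsCompact s)
    (h : LocallyLipschitzOnSet γ s) : ∃ C, LipschitzOnWith C γ s := by
  refine LocallyLipschitzOn.exists_lipschitzOnWith_of_compact hs fun t ht => ?_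
  obtain ⟨ε, hε, C, hC⟩ := h t ht
  exact ⟨C, _, inter_mem self_mem_nhdsWithin
    (mem_nhdsWithin_of_mem_nhds (Metric.ball_mem_nhds t hε)), hC⟩

theorem exists_chainCost_le_lintegral [TopologicalSpace.SeparableSpace X]
    (hKc : Continuous K) (hK : ∀ x, 0 ≤ K x) {σ : ℝ → X} (S : Finset ℝ) :
    ∀ a b, a ≤ b → ContinuousOn σ (Icc a b) → LocallyLipschitzOnSet σ (Ioo a b \ ↑S) →
      ∀ ε > 0, ∀ η > 0, ∃ c, ChainCost K ε (σ a) (σ b) c ∧ ENNReal.ofReal c ≤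
        (∫⁻ t in Ioo a b, ENNReal.ofReal (K (σ t) * metricDerivWithin σ univ t)) +
          ENNReal.ofReal η := by
  induction S using Finset.induction_on with
  | empty =>
    intro a b hab hcont hlip ε hε η hη
    rcases hab.eq_or_lt with rfl | hab'
    · exact ⟨0, .nil _, by simp⟩
    have hη3 : 0 < η / 3 := by positivity
    obtain ⟨δa, hδa, ha⟩ := exists_chainCost_le_of_dist_lt hKc hK (σ a) hε hη3
    obtain ⟨δb, hδb, hb⟩ := exists_chainCost_le_of_dist_lt hKc hK (σ b) hε hη3
    have hta : Tendsto σ (𝓝[>] a) (𝓝 (σ a)) :=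
      (hcont a (left_mem_Icc.2 hab)).mono_left
        (nhdsWithin_le_of_mem (Icc_mem_nhdsGT hab'))
    have htb : Tendsto σ (𝓝[<] b) (𝓝 (σ b)) :=
      (hcont b (right_mem_Icc.2 hab)).mono_left
        (nhdsWithin_le_of_mem (Icc_mem_nhdsLT hab'))
    set p := (a + b) / 2 with hp
    obtain ⟨a', hda, ha'⟩ := ((hta.eventually (Metric.ball_mem_nhds _ hδa)).and
      (Ioo_mem_nhdsGT (show a < p by rw [hp]; linarith))).exists
    obtain ⟨b', hdb, hb'⟩ := ((htb.eventually (Metric.ball_mem_nhds _ hδb)).and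
      (Ioo_mem_nhdsLT (show p < b by rw [hp]; linarith))).exists
    have hab'' : a' ≤ b' := (ha'.2.trans hb'.1).le
    have hsub : Icc a' b' ⊆ Ioo a b := fun t ht =>
      ⟨ha'.1.trans_le ht.1, ht.2.trans_lt hb'.2⟩
    obtain ⟨C, hC⟩ := (hlip.mono (by simpa using hsub)).exists_lipschitzOnWith
      (isCompact_Icc (a := a') (b := b'))
    obtain ⟨c, hc, hcI⟩ := hC.exists_chainCost_le hKc hK hab'' hε hη3
    obtain ⟨c₁, hc₁, hch₁⟩ := (ha _ hda).2
    obtain ⟨c₂, hc₂, hch₂⟩ := (hb _ hdb).1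
    refine ⟨c₁ + (c + c₂), hch₁.trans (hc.trans hch₂), ?_⟩
    have hmono : (∫⁻ t in Ioo a' b', ENNReal.ofReal (K (σ t) * metricDerivWithin σ univ t)) ≤
        ∫⁻ t in Ioo a b, ENNReal.ofReal (K (σ t) * metricDerivWithin σ univ t) :=
      lintegral_mono_set (Ioo_subset_Icc_self.trans hsub)
    calc ENNReal.ofReal (c₁ + (c + c₂))
        ≤ ENNReal.ofReal c + ENNReal.ofReal (η / 3 + η / 3) := by
          refine le_trans (ENNReal.ofReal_le_ofReal ?_) ENNReal.ofReal_add_le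
          linarith
      _ ≤ _ := by
          refine (add_le_add_left (hcI.trans (add_le_add_left hmono _)) _).trans_eq ?_
          rw [add_assoc, ← ENNReal.ofReal_add (by positivity) (by positivity)]
          congr 2
          ring
  | insert s S _ ih =>
    intro a b hab hcont hlip ε hε η hη
    by_cases hs : s ∈ Ioo a b
    · have hη2 : 0 < η / 2 := by positivity
      obtain ⟨c₁, hc₁, hI₁⟩ := ih a s hs.1.le (hcont.mono (Icc_subset_Icc_right hs.2.le))
        (hlip.mono fun t ht => ⟨⟨ht.1.1, ht.1.2.trans hs.2⟩, fun h => by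
          rcases Finset.mem_insert.1 h with h | h
          · exact ht.1.2.ne h
          · exact ht.2 h⟩) ε hε _ hη2
      obtain ⟨c₂, hc₂, hI₂⟩ := ih s b hs.2.le (hcont.mono (Icc_subset_Icc_left hs.1.le))
        (hlip.mono fun t ht => ⟨⟨hs.1.trans ht.1.1, ht.1.2⟩, fun h => by
          rcases Finset.mem_insert.1 h with h | h
          · exact ht.1.1.ne' h
          · exact ht.2 h⟩) ε hε _ hη2
      refine ⟨c₁ + c₂, hc₁.trans hc₂, ENNReal.ofReal_add_le.trans ((add_le_add hI₁ hI₂).trans ?_)⟩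
      rw [add_add_add_comm, ← ENNReal.ofReal_add hη2.le hη2.le, add_halves]
      gcongr
      rw [← lintegral_union measurableSet_Ioo]
      · exact lintegral_mono_set
          (union_subset (Ioo_subset_Ioo_right hs.2.le) (Ioo_subset_Ioo_left hs.1.le))
      · exact Set.disjoint_left.2 fun u hu hu' => absurd hu.2 (not_lt.2 hu'.1.le)
    · refine ih a b hab hcont (hlip.mono fun t ht => ⟨ht.1, fun h => ?_⟩) ε hε η hη
      rcases Finset.mem_insert.1 h with h | h
      · exact hs (h ▸ ht.1)
      · exact ht.2 h

theorem frequently_leftEndFilter {I : Set ℝ} {t₀ : ℝ} (ht₀ : t₀ ∈ I) :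
    ∃ᶠ a in leftEndFilter I, a ∈ I ∧ a ≤ t₀ := by
  unfold leftEndFilter
  split_ifs with hb
  · rw [frequently_iff]
    intro U hU
    obtain ⟨V, hV, hVU⟩ := mem_nhdsWithin_iff_exists_mem_nhds_inter.1 hU
    obtain ⟨δ, hδ, hδV⟩ := Metric.mem_nhds_iff.1 hV
    obtain ⟨a, haI, ha⟩ := exists_lt_of_csInf_lt ⟨t₀, ht₀⟩ (lt_add_of_pos_right (sInf I) hδ)
    have hmin : min a t₀ ∈ I := by rcases min_choice a t₀ with h | h <;> rw [h] <;> assumption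
    have hlow := csInf_le hb hmin
    refine ⟨min a t₀, hVU ⟨hδV ?_, hmin⟩, hmin, min_le_right _ _⟩
    rw [Metric.mem_ball, Real.dist_eq, abs_lt]
    constructor <;> linarith [min_le_left a t₀]
  · rw [frequently_iff]
    intro U hU
    obtain ⟨N, hN⟩ := mem_atBot_sets.1 (mem_inf_principal.1 hU)
    rw [not_bddBelow_iff] at hb
    obtain ⟨a, haI, ha⟩ := hb (min N t₀)
    exact ⟨a, hN a (ha.le.trans (min_le_left _ _)) haI, haI,
      ha.le.trans (min_le_right _ _)⟩

theorem frequently_rightEndFilter {I : Set ℝ} {t₀ : ℝ} (ht₀ : t₀ ∈ I) :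
    ∃ᶠ b in rightEndFilter I, b ∈ I ∧ t₀ ≤ b := by
  unfold rightEndFilter
  split_ifs with hb
  · rw [frequently_iff]
    intro U hU
    obtain ⟨V, hV, hVU⟩ := mem_nhdsWithin_iff_exists_mem_nhds_inter.1 hU
    obtain ⟨δ, hδ, hδV⟩ := Metric.mem_nhds_iff.1 hV
    obtain ⟨a, haI, ha⟩ := exists_lt_of_lt_csSup ⟨t₀, ht₀⟩ (sub_lt_self (sSup I) hδ)
    have hmax : max a t₀ ∈ I := by rcases max_choice a t₀ with h | h <;> rw [h] <;> assumption
    have hup := le_csSup hb hmax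
    refine ⟨max a t₀, hVU ⟨hδV ?_, hmax⟩, hmax, le_max_right _ _⟩
    rw [Metric.mem_ball, Real.dist_eq, abs_lt]
    constructor <;> linarith [le_max_left a t₀]
  · rw [frequently_iff]
    intro U hU
    obtain ⟨N, hN⟩ := mem_atTop_sets.1 (mem_inf_principal.1 hU)
    rw [not_bddAbove_iff] at hb
    obtain ⟨a, haI, ha⟩ := hb (max N t₀)
    exact ⟨a, hN a ((le_max_left _ _).trans ha.le) haI, haI,
      (le_max_right _ _).trans ha.le⟩

theorem IsPathOn.exists_dist_lt {γ : ℝ → X} {I : Set ℝ} {x y : X} (h : IsPathOn γ I x y) {δ δ' : ℝ}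
    (hδ : 0 < δ) (hδ' : 0 < δ') :
    ∃ a ∈ I, ∃ b ∈ I, a ≤ b ∧ dist (γ a) x < δ ∧ dist (γ b) y < δ' := by
  obtain ⟨⟨t₀, ht₀⟩, -, -, hx, hy⟩ := h
  obtain ⟨a, ⟨haI, hat⟩, ha⟩ := ((frequently_leftEndFilter ht₀).and_eventually
    (hx (Metric.ball_mem_nhds x hδ))).exists
  obtain ⟨b, ⟨hbI, htb⟩, hb⟩ := ((frequently_rightEndFilter ht₀).and_eventually
    (hy (Metric.ball_mem_nhds y hδ'))).exists
  exact ⟨a, haI, b, hbI, hat.trans htb, ha, hb⟩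

/-- To bound chain costs between the ends of a path it is enough to bound them between two
points of the path. -/
theorem IsPathOn.exists_chainCost_le (hKc : Continuous K) (hK : ∀ x, 0 ≤ K x) {γ : ℝ → X}
    {I : Set ℝ} {x y : X} (h : IsPathOn γ I x y) {B : ℝ≥0∞} {ε : ℝ} (hε : 0 < ε)
    (hB : ∀ η > 0, ∀ a ∈ I, ∀ b ∈ I, a ≤ b →
      ∃ c, ChainCost K ε (γ a) (γ b) c ∧ ENNReal.ofReal c ≤ B + ENNReal.ofReal η)
    {η : ℝ} (hη : 0 < η) :
    ∃ c, ChainCost K ε x y c ∧ ENNReal.ofReal c ≤ B + ENNReal.ofReal η := by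
  have hη3 : 0 < η / 3 := by positivity
  obtain ⟨δx, hδx, hx⟩ := exists_chainCost_le_of_dist_lt hKc hK x hε hη3
  obtain ⟨δy, hδy, hy⟩ := exists_chainCost_le_of_dist_lt hKc hK y hε hη3
  obtain ⟨a, ha, b, hb, hab, hda, hdb⟩ := h.exists_dist_lt hδx hδy
  obtain ⟨c, hc, hcB⟩ := hB _ hη3 a ha b hb hab
  obtain ⟨c₁, hc₁, hch₁⟩ := (hx _ hda).2
  obtain ⟨c₂, hc₂, hch₂⟩ := (hy _ hdb).1
  refine ⟨c₁ + (c + c₂), hch₁.trans (hc.trans hch₂), ?_⟩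
  calc ENNReal.ofReal (c₁ + (c + c₂))
      ≤ ENNReal.ofReal c + ENNReal.ofReal (η / 3 + η / 3) := by
        refine le_trans (ENNReal.ofReal_le_ofReal ?_) ENNReal.ofReal_add_le
        linarith
    _ ≤ _ := by
        refine (add_le_add_left hcB _).trans_eq ?_
        rw [add_assoc, ← ENNReal.ofReal_add (by positivity) (by positivity)]
        congr 2
        ring

theorem IsPathOn.exists_chainCost_le_KLength [TopologicalSpace.SeparableSpace X]
    (hKc : Continuous K) (hK : ∀ x, 0 ≤ K x) {γ : ℝ → X} {I : Set ℝ} {x y : X}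
    (hp : PiecewiseLocLipOn γ I) (h : IsPathOn γ I x y) {ε η : ℝ} (hε : 0 < ε) (hη : 0 < η) :
    ∃ c, ChainCost K ε x y c ∧ ENNReal.ofReal c ≤ KLength K γ I + ENNReal.ofReal η := by
  refine h.exists_chainCost_le hKc hK hε (fun η hη a ha b hb hab => ?_) hη
  obtain ⟨hcont, S, hS⟩ := hp
  have hsub : Icc a b ⊆ I := h.2.1.out ha hb
  obtain ⟨c, hc, hcI⟩ := exists_chainCost_le_lintegral hKc hK S a b hab (hcont.mono hsub)
    (hS.mono (sdiff_subset_sdiff_left (Ioo_subset_Icc_self.trans hsub))) ε hε η hη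
  refine ⟨c, hc, hcI.trans ?_⟩
  gcongr
  calc (∫⁻ t in Ioo a b, ENNReal.ofReal (K (γ t) * metricDerivWithin γ univ t))
      = ∫⁻ t in Ioo a b, ENNReal.ofReal (K (γ t) * metricDerivWithin γ I t) := by
        refine setLIntegral_congr_fun measurableSet_Ioo fun t ht => ?_
        have htI : t ∈ interior I := interior_mono hsub (by rwa [interior_Icc])
        simp only [metricDerivWithin_of_mem_interior htI]
    _ ≤ KLength K γ I := lintegral_mono_set (Ioo_subset_Icc_self.trans hsub)

theorem chainDistLE_of_dK_le [TopologicalSpace.SeparableSpace X]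
    (hKc : Continuous K) (hK : ∀ x, 0 ≤ K x) {x y : X} {c : ℝ} (hc : 0 ≤ c)
    (h : dK K x y ≤ ENNReal.ofReal c) : ChainDistLE K x y c := by
  intro ε hε η hη
  have hlt : dK K x y < ENNReal.ofReal (c + η / 2) :=
    h.trans_lt ((ENNReal.ofReal_lt_ofReal_iff (by linarith)).2 (by linarith))
  simp only [dK, iInf_lt_iff] at hlt
  obtain ⟨γ, I, hp, hpath, hlen⟩ := hlt
  obtain ⟨c', hc', hle⟩ := hpath.exists_chainCost_le_KLength hKc hK hp hε
    (show 0 < η / 2 by positivity)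
  refine ⟨c', ?_, hc'⟩
  have h1 : ENNReal.ofReal c' < ENNReal.ofReal (c + η) := by
    refine hle.trans_lt ?_
    have : ENNReal.ofReal (c + η) = ENNReal.ofReal (c + η / 2) + ENNReal.ofReal (η / 2) := by
      rw [← ENNReal.ofReal_add (by positivity) (by positivity)]
      congr 1
      ring
    rw [this]
    exact ENNReal.add_lt_add_right ENNReal.ofReal_ne_top hlen
  exact (ENNReal.ofReal_lt_ofReal_iff (by positivity)).1 h1

/-- In a length space any two points are at finite chain distance. -/
theorem IsLengthSpace.exists_chainDistLE [ProperSpace X] (hlen : IsLengthSpace X)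
    (hKc : Continuous K) (hK : ∀ x, 0 ≤ K x) (x y : X) : ∃ c, ChainDistLE K x y c := by
  have hlt : geodDist x y < ⊤ := by rw [hlen x y]; exact edist_lt_top x y
  simp only [geodDist, iInf_lt_iff] at hlt
  obtain ⟨γ, I, hpath, hvar⟩ := hlt
  obtain ⟨t₀, ht₀⟩ := hpath.1
  set V := (eVariationOn γ I).toReal with hV
  obtain ⟨M, hM⟩ := (isCompact_closedBall (γ t₀) V).bddAbove_image hKc.continuousOn
  have hKM : ∀ t ∈ I, K (γ t) ≤ M := fun t ht => by
    refine hM ⟨γ t, ?_, rfl⟩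
    rw [Metric.mem_closedBall, dist_edist]
    exact ENNReal.toReal_mono hvar.ne (eVariationOn.edist_le γ ht ht₀)
  have hM0 : 0 ≤ M := (hK _).trans (hKM t₀ ht₀)
  refine ⟨M * V, fun ε hε η hη => ?_⟩
  obtain ⟨c, hc, hle⟩ : ∃ c, ChainCost K ε x y c ∧ ENNReal.ofReal c ≤
      ENNReal.ofReal M * eVariationOn γ I + ENNReal.ofReal (η / 2) := by
    refine hpath.exists_chainCost_le hKc hK hε ?_ (by positivity)
    intro η _ a ha b hb hab
    have hsub : Icc a b ⊆ I := hpath.2.1.out ha hb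
    obtain ⟨δ, hδ, h1⟩ := Metric.uniformContinuousOn_iff.1
      (isCompact_Icc.uniformContinuousOn_of_continuous (hpath.2.2.1.mono hsub)) ε hε
    obtain ⟨c, hc, hcG⟩ : ∃ c, ChainCost K ε (γ a) (γ b) c ∧
        ENNReal.ofReal c ≤ ENNReal.ofReal M * eVariationOn γ (univ ∩ Icc a b) := by
      refine exists_chainCost_le_of_superadditive hab hδ
        (G := fun s t => ENNReal.ofReal M * eVariationOn γ (univ ∩ Icc s t)) ?_ ?_
      · intro r s t hrs hst
        rw [← mul_add, eVariationOn.Icc_add_Icc γ hrs hst (mem_univ s)]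
      · intro s hs t ht hst hd
        refine ⟨h1 s hs t ht ?_, ?_⟩
        · rw [Real.dist_eq, abs_lt]; constructor <;> linarith
        · rw [ENNReal.ofReal_mul (hK _), ← edist_dist, univ_inter]
          gcongr
          · exact hKM s (hsub hs)
          · exact eVariationOn.edist_le γ (left_mem_Icc.2 hst) (right_mem_Icc.2 hst)
    refine ⟨c, hc, hcG.trans (le_add_right ?_)⟩
    gcongr
    rw [univ_inter]
    exact eVariationOn.mono γ hsub
  refine ⟨c, ?_, hc⟩
  rw [← ENNReal.ofReal_toReal hvar.ne, ← ENNReal.ofReal_mul hM0,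
    ← ENNReal.ofReal_add (by positivity) (by positivity),
    ENNReal.ofReal_le_ofReal_iff (by positivity)] at hle
  linarith

end PathsToChains

section Geodesic

variable {X : Type*} [MetricSpace X] {K : X → ℝ}

/-- A chain can be parametrised by its cost, up to an error controlled by the mesh. -/
theorem ChainCost.exists_parametrization (hK : ∀ x, 0 ≤ K x) {ε M c : ℝ} (hε : 0 < ε) {x y : X}
    (h : ChainCost K ε x y c) (hM : ∀ w c', ChainCost K ε x w c' → c' ≤ c → K w ≤ M) :
    ∃ z : ℝ → X, (∀ s, ∃ e ≤ max s 0, ChainCost K ε x (z s) e) ∧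
      (∀ s, ∃ e ≤ max (c - s) 0 + M * ε, ChainCost K ε (z s) y e) ∧
      ∀ s s', s ≤ s' → ∃ e ≤ s' - s + M * ε, ChainCost K ε (z s) (z s') e := by
  induction h with
  | nil x =>
    have hM0 : 0 ≤ M * ε := mul_nonneg ((hK x).trans (hM x 0 (.nil x) le_rfl)) hε.le
    refine ⟨fun _ => x, fun s => ⟨0, le_max_right _ _, .nil x⟩, fun s => ⟨0, ?_, .nil x⟩,
      fun s s' hs => ⟨0, by linarith, .nil x⟩⟩
    have := le_max_right (0 - s) 0
    linarith
  | @cons x x' y c hxx' hc ih =>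
    obtain ⟨z, hz1, hz2, hz3⟩ := ih fun w c' hw hc' => hM w _ (.cons hxx' hw) (by linarith)
    set k := K x * dist x x' with hk
    have hk0 : 0 ≤ k := mul_nonneg (hK x) dist_nonneg
    have hc0 : 0 ≤ c := hc.nonneg hK
    have hMx : K x ≤ M := hM x 0 (.nil x) (by linarith)
    have hkM : k ≤ M * ε := mul_le_mul hMx hxx'.le dist_nonneg ((hK x).trans hMx)
    refine ⟨fun s => if s < k then x else z (s - k), fun s => ?_, fun s => ?_, fun s s' hs => ?_⟩
    · by_cases hsk : s < k
      · simp only [hsk, if_true]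
        exact ⟨0, le_max_right _ _, .nil x⟩
      · simp only [hsk, if_false]
        obtain ⟨e, he, hch⟩ := hz1 (s - k)
        refine ⟨_, ?_, .cons hxx' hch⟩
        rw [max_eq_left (by linarith)] at he
        exact le_max_of_le_left (by linarith)
    · by_cases hsk : s < k
      · simp only [hsk, if_true]
        refine ⟨_, ?_, .cons hxx' hc⟩
        have := le_max_left (k + c - s) 0
        linarith
      · simp only [hsk, if_false]
        obtain ⟨e, he, hch⟩ := hz2 (s - k)
        exact ⟨e, he.trans_eq (by ring_nf), hch⟩
    · by_cases hsk' : s' < k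
      · simp only [hsk', hs.trans_lt hsk', if_true]
        exact ⟨0, by linarith, .nil x⟩
      by_cases hsk : s < k
      · simp only [hsk, hsk', if_true, if_false]
        obtain ⟨e, he, hch⟩ := hz1 (s' - k)
        refine ⟨_, ?_, .cons hxx' hch⟩
        rw [max_eq_left (by linarith)] at he
        linarith
      · simp only [hsk, hsk', if_false]
        obtain ⟨e, he, hch⟩ := hz3 (s - k) (s' - k) (by linarith)
        exact ⟨e, by linarith, hch⟩

theorem ChainDistLE.of_tendsto (hKc : Continuous K) (hK : ∀ x, 0 ≤ K x) {ι : Type*} {l : Filter ι}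
    [l.NeBot] {p q : ι → X} {ε b : ι → ℝ} {x y : X} {c : ℝ} (hp : Tendsto p l (𝓝 x))
    (hq : Tendsto q l (𝓝 y)) (hε : Tendsto ε l (𝓝 0)) (hb : Tendsto b l (𝓝 c))
    (h : ∀ i, ∃ e ≤ b i, ChainCost K (ε i) (p i) (q i) e) : ChainDistLE K x y c := by
  intro ε' hε' η hη
  have hη4 : 0 < η / 4 := by positivity
  obtain ⟨δx, hδx, hx⟩ := exists_chainCost_le_of_dist_lt hKc hK x hε' hη4
  obtain ⟨δy, hδy, hy⟩ := exists_chainCost_le_of_dist_lt hKc hK y hε' hη4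
  obtain ⟨i, hpi, hqi, hεi, hbi⟩ := ((hp.eventually (Metric.ball_mem_nhds x hδx)).and
    ((hq.eventually (Metric.ball_mem_nhds y hδy)).and ((hε.eventually_lt_const hε').and
      (hb.eventually_lt_const (show c < c + η / 4 by linarith))))).exists
  obtain ⟨e, he, hch⟩ := h i
  obtain ⟨c₁, hc₁, hch₁⟩ := (hx _ hpi).2
  obtain ⟨c₂, hc₂, hch₂⟩ := (hy _ hqi).1
  exact ⟨c₁ + (e + c₂), by linarith, hch₁.trans ((hch.mono hεi.le).trans hch₂)⟩

theorem ChainDistLE.exists_geodesic [ProperSpace X] (hKc : Continuous K) (hK : ∀ x, 0 ≤ K x)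
    {x y : X} {D ε₀ R : ℝ} (hD : ChainDistLE K x y D) (hε₀ : 0 < ε₀)
    (hR : ∀ z c, c ≤ D + 1 → ChainCost K ε₀ x z c → dist x z ≤ R) :
    ∃ γ : ℝ → X, ∀ s ∈ Icc 0 D, ChainDistLE K x (γ s) s ∧ ChainDistLE K (γ s) y (D - s) ∧
      ∀ s' ∈ Icc 0 D, s ≤ s' → ChainDistLE K (γ s) (γ s') (s' - s) := by
  obtain ⟨M, hM⟩ := (isCompact_closedBall x R).bddAbove_image hKc.continuousOn
  have hpos : ∀ n : ℕ, (0 : ℝ) < 1 / (n + 1) := fun n => Nat.one_div_pos_of_nat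
  have hle1 : ∀ n : ℕ, 1 / ((n : ℝ) + 1) ≤ 1 := fun n => by
    rw [div_le_one (by positivity)]
    linarith [n.cast_nonneg (α := ℝ)]
  set ε : ℕ → ℝ := fun n => ε₀ * (1 / (n + 1)) with hεdef
  have hε : ∀ n, 0 < ε n := fun n => mul_pos hε₀ (hpos n)
  have hεε₀ : ∀ n, ε n ≤ ε₀ := fun n => mul_le_of_le_one_right hε₀.le (hle1 n)
  choose c hc hch using fun n => hD (ε n) (hε n) _ (hpos n)
  have hball : ∀ n w c', ChainCost K (ε n) x w c' → c' ≤ D + 1 → w ∈ Metric.closedBall x R :=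
    fun n w c' hw hc' => by
      rw [Metric.mem_closedBall']
      exact hR w c' hc' (hw.mono (hεε₀ n))
  choose z hz1 hz2 hz3 using fun n => (hch n).exists_parametrization (M := M) hK (hε n)
    fun w c' hw hc' => hM ⟨w, hball n w c' hw (by linarith [hc n, hle1 n]), rfl⟩
  set U : Ultrafilter ℕ := hyperfilter ℕ with hU
  have hUtop : (U : Filter ℕ) ≤ atTop := by
    rw [← Nat.cofinite_eq_atTop]
    exact hyperfilter_le_cofinite
  have hlim : ∀ s, ∃ p, s ∈ Icc 0 D → Tendsto (fun n => z n s) U (𝓝 p) := by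
    intro s
    by_cases hs : s ∈ Icc 0 D
    · obtain ⟨p, -, hp⟩ := (isCompact_closedBall x R).ultrafilter_le_nhds (U.map fun n => z n s) (by
        rw [le_principal_iff, Ultrafilter.mem_coe, Ultrafilter.mem_map]
        refine univ_mem' fun n => ?_
        obtain ⟨e, he, hchain⟩ := hz1 n s
        rw [max_eq_left hs.1] at he
        exact hball n _ e hchain (by linarith [hs.2]))
      exact ⟨p, fun _ => hp⟩
    · exact ⟨x, fun h => absurd h hs⟩
  choose γ hγ using hlim
  have hone : Tendsto (fun n : ℕ => 1 / ((n : ℝ) + 1)) U (𝓝 0) :=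
    tendsto_one_div_add_atTop_nhds_zero_nat.mono_left hUtop
  have hε0 : Tendsto ε U (𝓝 0) := by simpa [hεdef] using hone.const_mul ε₀
  have hMε : Tendsto (fun n => M * ε n) U (𝓝 0) := by simpa using hε0.const_mul M
  refine ⟨γ, fun s hs => ⟨?_, ?_, fun s' hs' hss' => ?_⟩⟩
  · refine .of_tendsto hKc hK tendsto_const_nhds (hγ s hs) hε0
      (tendsto_const_nhds (x := s)) fun n => ?_
    simpa only [max_eq_left hs.1] using hz1 n s
  · refine .of_tendsto hKc hK (hγ s hs) tendsto_const_nhds hε0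
      (b := fun n : ℕ => D - s + 1 / ((n : ℝ) + 1) + M * ε n) ?_ fun n => ?_
    · simpa using ((hone.const_add (D - s)).add hMε)
    · obtain ⟨e, he, hchain⟩ := hz2 n s
      refine ⟨e, he.trans ?_, hchain⟩
      gcongr
      refine max_le (by linarith [hc n]) ?_
      linarith [hs.2, hpos n]
  · refine .of_tendsto hKc hK (hγ s hs) (hγ s' hs') hε0
      (b := fun n => s' - s + M * ε n) ?_ fun n => hz3 n s s' hss'
    simpa using hMε.const_add (s' - s)

end Geodesic

section ChainLipschitz

variable {X : Type*} [MetricSpace X] {K : X → ℝ} {γ : ℝ → X}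

theorem ChainDistLE.continuous_curve [ProperSpace X] (hKc : Continuous K) (hK : ∀ x, 0 ≤ K x)
    (hfin : {x | K x = 0}.Finite) (hγ : ∀ s s', s ≤ s' → ChainDistLE K (γ s) (γ s') (s' - s)) :
    Continuous γ := by
  refine Metric.continuous_iff.2 fun s ρ hρ => ?_
  obtain ⟨e₀, he₀, h⟩ := exists_pos_dist_lt_of_chainDistLE hKc hK hfin (γ s) hρ
  refine ⟨e₀, he₀, fun t ht => ?_⟩
  rw [dist_comm]
  rw [Real.dist_eq, abs_lt] at ht
  rcases le_total s t with hst | hst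
  · exact h _ (t - s) (by linarith) (.inl (hγ s t hst))
  · exact h _ (s - t) (by linarith) (.inr (hγ t s hst))

/-- Away from the zeros of `K`, a curve that is `1`-Lipschitz for the chain distance is locally
`1 / c`-Lipschitz as soon as `c` is smaller than `K`. -/
theorem ChainDistLE.exists_mul_dist_le (hKc : Continuous K) (hK : ∀ x, 0 ≤ K x)
    (hγ : ∀ s s', s ≤ s' → ChainDistLE K (γ s) (γ s') (s' - s)) (hγc : Continuous γ) {s c : ℝ}
    (hc : 0 ≤ c) (hcK : c < K (γ s)) :
    ∃ δ > 0, ∀ s₁ ∈ Metric.ball s δ, ∀ s₂ ∈ Metric.ball s δ,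
      c * dist (γ s₁) (γ s₂) ≤ |s₁ - s₂| := by
  obtain ⟨ρ, hρ, hball⟩ := Metric.mem_nhds_iff.1 (hKc.continuousAt.eventually (lt_mem_nhds hcK))
  obtain ⟨δ, hδ, hδρ⟩ := Metric.continuous_iff.1 hγc s (ρ / 8) (by positivity)
  refine ⟨δ, hδ, fun s₁ h₁ s₂ h₂ => ?_⟩
  have h₁' := hδρ s₁ h₁
  have h₂' := hδρ s₂ h₂
  have hd : dist (γ s₁) (γ s₂) ≤ ρ / 4 := by
    linarith [dist_triangle_right (γ s₁) (γ s₂) (γ s)]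
  have key := ChainDistLE.mul_min_dist_le (x := γ s₁) (y := γ s₂) (e := |s₁ - s₂|) hK
    (show 0 < ρ / 4 by positivity) hc (fun u hu => le_of_lt (hball ?_)) ?_
  · rwa [min_eq_right hd] at key
  · rw [Metric.mem_ball]
    linarith [dist_triangle_left u (γ s) (γ s₁)]
  · rcases le_total s₁ s₂ with h | h
    · rw [abs_sub_comm, abs_of_nonneg (by linarith)]
      exact .inl (hγ _ _ h)
    · rw [abs_of_nonneg (by linarith)]
      exact .inr (hγ _ _ h)

theorem ChainDistLE.locallyLipschitzOnSet (hKc : Continuous K) (hK : ∀ x, 0 ≤ K x)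
    (hγ : ∀ s s', s ≤ s' → ChainDistLE K (γ s) (γ s') (s' - s)) (hγc : Continuous γ) {s : Set ℝ}
    (hs : ∀ t ∈ s, 0 < K (γ t)) : LocallyLipschitzOnSet γ s := by
  intro t ht
  have hpos := hs t ht
  obtain ⟨δ, hδ, h⟩ := exists_mul_dist_le hKc hK hγ hγc (half_pos hpos).le (half_lt_self hpos)
  refine ⟨δ, hδ, (K (γ t) / 2)⁻¹.toNNReal, LipschitzOnWith.of_dist_le_mul fun u hu v hv => ?_⟩
  rw [Real.coe_toNNReal _ (by positivity), inv_mul_eq_div, le_div_iff₀' (half_pos hpos)]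
  exact h u hu.2 v hv.2

theorem ChainDistLE.mul_metricDerivWithin_le_one (hKc : Continuous K) (hK : ∀ x, 0 ≤ K x)
    (hγ : ∀ s s', s ≤ s' → ChainDistLE K (γ s) (γ s') (s' - s)) (hγc : Continuous γ) (s : ℝ) :
    K (γ s) * metricDerivWithin γ univ s ≤ 1 := by
  rcases (hK (γ s)).eq_or_lt with h0 | hpos
  · rw [← h0, zero_mul]
    exact zero_le_one
  have hlt : ∀ c ∈ Ioo 0 (K (γ s)), c * metricDerivWithin γ univ s ≤ 1 := by
    intro c hc
    obtain ⟨δ, hδ, h⟩ := exists_mul_dist_le hKc hK hγ hγc hc.1.le hc.2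
    have : metricDerivWithin γ univ s ≤ c⁻¹ := by
      refine metricDerivWithin_univ_le (inv_nonneg.2 hc.1.le) (Eventually.frequently ?_)
      filter_upwards [mem_nhdsWithin_of_mem_nhds (Metric.ball_mem_nhds s hδ)] with t ht
      rw [inv_mul_eq_div, le_div_iff₀' hc.1]
      exact h t ht s (Metric.mem_ball_self hδ)
    calc c * metricDerivWithin γ univ s ≤ c * c⁻¹ := mul_le_mul_of_nonneg_left this hc.1.le
      _ = 1 := mul_inv_cancel₀ hc.1.ne'
  have hlim : Tendsto (fun c => c * metricDerivWithin γ univ s) (𝓝[<] K (γ s))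
      (𝓝 (K (γ s) * metricDerivWithin γ univ s)) :=
    ((continuous_id.mul continuous_const).tendsto _).mono_left nhdsWithin_le_nhds
  refine le_of_tendsto hlim ?_
  filter_upwards [Ioo_mem_nhdsLT hpos] with c hc using hlt c hc

theorem isPathOn_Icc {a b : ℝ} (hab : a ≤ b) (hγc : Continuous γ) :
    IsPathOn γ (Icc a b) (γ a) (γ b) := by
  refine ⟨nonempty_Icc.2 hab, ordConnected_Icc, hγc.continuousOn, ?_, ?_⟩
  · rw [leftEndFilter, if_pos bddBelow_Icc, csInf_Icc hab]
    exact hγc.continuousWithinAt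
  · rw [rightEndFilter, if_pos bddAbove_Icc, csSup_Icc hab]
    exact hγc.continuousWithinAt

theorem ChainDistLE.dK_le (hKc : Continuous K) (hK : ∀ x, 0 ≤ K x)
    (hγ : ∀ s s', s ≤ s' → ChainDistLE K (γ s) (γ s') (s' - s)) (hγc : Continuous γ) {a b : ℝ}
    (hab : a ≤ b) (hZ : {s ∈ Icc a b | K (γ s) = 0}.Finite) :
    dK K (γ a) (γ b) ≤ ENNReal.ofReal (b - a) := by
  have hp : PiecewiseLocLipOn γ (Icc a b) := by
    refine ⟨hγc.continuousOn, hZ.toFinset, locallyLipschitzOnSet hKc hK hγ hγc fun t ht => ?_⟩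
    exact (hK _).lt_of_ne' fun h => ht.2 (by simpa using ⟨ht.1, h⟩)
  refine (iInf₂_le_of_le γ (Icc a b) (iInf₂_le_of_le hp (isPathOn_Icc hab hγc) le_rfl)).trans ?_
  calc KLength K γ (Icc a b) ≤ ∫⁻ _ in Ioo a b, 1 := by
        rw [KLength, ← restrict_Ioo_eq_restrict_Icc]
        refine setLIntegral_mono' measurableSet_Ioo fun t ht => ?_
        rw [metricDerivWithin_of_mem_interior (by rwa [interior_Icc])]
        exact ENNReal.ofReal_le_one.2 (mul_metricDerivWithin_le_one hKc hK hγ hγc t)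
    _ = ENNReal.ofReal (b - a) := by simp

/-- Under the strict triangle inequality there is a minimising geodesic from `x` to `y` that
avoids the zeros of `K` except at its ends. -/
theorem exists_geodesic_avoiding_zeros [ProperSpace X] (hlen : IsLengthSpace X)
    (hKc : Continuous K) (hK : ∀ x, 0 ≤ K x) (hfin : {x | K x = 0}.Finite) {x y : X}
    (hR : ∀ B, ∃ ε₀ > 0, ∃ R, ∀ z c, c ≤ B → ChainCost K ε₀ x z c → dist x z ≤ R)
    (hSTI : ∀ z, K z = 0 → z ≠ x → z ≠ y → dK K x y < dK K x z + dK K z y) :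
    ∃ D ≥ 0, ENNReal.ofReal D ≤ dK K x y ∧ ∃ γ : ℝ → X, Continuous γ ∧
      (∀ s s', s ≤ s' → ChainDistLE K (γ s) (γ s') (s' - s)) ∧
      (∀ s ≤ 0, γ s = x) ∧ (∀ s ≥ D, γ s = y) ∧ ∀ s ∈ Ioo 0 D, K (γ s) ≠ 0 := by
  set A := {c | ChainDistLE K x y c} with hA
  have hAne : A.Nonempty := hlen.exists_chainDistLE hKc hK x y
  have hAbdd : BddBelow A := ⟨0, fun c hc => ChainDistLE.nonneg hK hc⟩
  set D := sInf A with hDdef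
  have hD0 : 0 ≤ D := le_csInf hAne fun c hc => ChainDistLE.nonneg hK hc
  have hDmem : ChainDistLE K x y D := by
    intro ε hε η hη
    obtain ⟨c, hc, hcD⟩ := exists_lt_of_csInf_lt hAne
      (show sInf A < D + η / 2 by rw [← hDdef]; linarith)
    obtain ⟨c', hc', hch⟩ := hc ε hε (η / 2) (half_pos hη)
    exact ⟨c', by linarith, hch⟩
  have hDle : ENNReal.ofReal D ≤ dK K x y := by
    rcases eq_or_ne (dK K x y) ⊤ with h | h
    · exact h ▸ le_top
    · rw [ENNReal.ofReal_le_iff_le_toReal h]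
      exact csInf_le hAbdd
        (chainDistLE_of_dK_le hKc hK ENNReal.toReal_nonneg (ENNReal.ofReal_toReal h).ge)
  obtain ⟨ε₀, hε₀, R, hR⟩ := hR (D + 1)
  obtain ⟨γ₀, hγ₀⟩ := hDmem.exists_geodesic hKc hK hε₀ hR
  have h0D : (0 : ℝ) ∈ Icc 0 D := left_mem_Icc.2 hD0
  have hDD : D ∈ Icc 0 D := right_mem_Icc.2 hD0
  set γ : ℝ → X := fun s => γ₀ (projIcc 0 D hD0 s) with hγdef
  have hγ : ∀ s s', s ≤ s' → ChainDistLE K (γ s) (γ s') (s' - s) := by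
    intro s s' hs
    refine ((hγ₀ _ (projIcc 0 D hD0 s).2).2.2 _ (projIcc 0 D hD0 s').2
      (monotone_projIcc hD0 hs)).mono ?_
    simp only [coe_projIcc]
    have := abs_max_sub_max_le_max (0 : ℝ) (min D s') 0 (min D s)
    have h2 := abs_min_sub_min_le_max D s' D s
    simp only [sub_self, abs_zero, abs_of_nonneg (sub_nonneg.2 hs)] at this h2
    rw [max_eq_right (by linarith)] at h2
    exact (le_abs_self _).trans (this.trans (max_le (by linarith) h2))
  have hγc : Continuous γ := ChainDistLE.continuous_curve hKc hK hfin hγ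
  have hx : γ₀ 0 = x := (eq_of_chainDistLE_zero hKc hK hfin (hγ₀ 0 h0D).1).symm
  have hy : γ₀ D = y := eq_of_chainDistLE_zero hKc hK hfin (by simpa using (hγ₀ D hDD).2.1)
  have hγx : ∀ s ≤ 0, γ s = x := fun s hs => by
    simp only [hγdef, projIcc_of_le_left hD0 hs]
    exact hx
  have hγy : ∀ s ≥ D, γ s = y := fun s hs => by
    simp only [hγdef, projIcc_of_right_le hD0 hs]
    exact hy
  have hinj : InjOn γ (Icc 0 D) := by
    have aux : ∀ s ∈ Icc 0 D, ∀ t ∈ Icc 0 D, s < t → γ s ≠ γ t := by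
      intro s hs t ht hst h
      have h1 := hγ 0 s hs.1
      have h2 := hγ t D ht.2
      rw [hγx 0 le_rfl, h] at h1
      rw [hγy D le_rfl] at h2
      have := csInf_le hAbdd (h1.trans h2)
      linarith
    intro s hs t ht h
    rcases lt_trichotomy s t with hlt | heq | hlt
    · exact absurd h (aux s hs t ht hlt)
    · exact heq
    · exact absurd h.symm (aux t ht s hs hlt)
  have hZ : ∀ a b, 0 ≤ a → b ≤ D → {s ∈ Icc a b | K (γ s) = 0}.Finite := fun a b ha hb =>
    Set.Finite.of_finite_image (f := γ) (hfin.subset (by rintro _ ⟨s, hs, rfl⟩; exact hs.2))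
      (hinj.mono ((sep_subset _ _).trans (Icc_subset_Icc ha hb)))
  refine ⟨D, hD0, hDle, γ, hγc, hγ, hγx, hγy, fun s hs h => ?_⟩
  have hsI : s ∈ Icc 0 D := Ioo_subset_Icc_self hs
  have hlt := hSTI (γ s) h
    (fun he => hs.1.ne' (hinj hsI h0D (he.trans (hγx 0 le_rfl).symm)))
    (fun he => hs.2.ne (hinj hsI hDD (he.trans (hγy D le_rfl).symm)))
  have h1 := ChainDistLE.dK_le hKc hK hγ hγc hs.1.le (hZ 0 s le_rfl hs.2.le)
  have h2 := ChainDistLE.dK_le hKc hK hγ hγc hs.2.le (hZ s D hs.1.le le_rfl)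
  rw [hγx 0 le_rfl] at h1
  rw [hγy D le_rfl] at h2
  have h3 := hlt.trans_le (add_le_add h1 h2)
  rw [← ENNReal.ofReal_add (by linarith [hs.1]) (by linarith [hs.2])] at h3
  refine absurd (h3.trans_le (le_trans (ENNReal.ofReal_le_ofReal ?_) hDle)) (lt_irrefl _)
  linarith

end ChainLipschitz

section TimeChange

/-- The generalised inverse of a monotone function on `(0, D)`. -/
theorem MonotoneOn.exists_generalized_inverse {φ : ℝ → ℝ} {D : ℝ} (hD : 0 < D)
    (hφ : MonotoneOn φ (Ioo 0 D)) :
    ∃ ψ : ℝ → ℝ, (∀ t, ψ t ∈ Icc 0 D) ∧ (∀ s ∈ Ioo 0 D, ∀ t, φ s ≤ t → s ≤ ψ t) ∧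
      ∀ s ∈ Ioo 0 D, ∀ t, s < ψ t → φ s ≤ t := by
  have hbdd : ∀ t, BddAbove (insert 0 {s ∈ Ioo 0 D | φ s ≤ t}) := fun t =>
    ⟨D, by rintro s (rfl | hs); exacts [hD.le, hs.1.2.le]⟩
  refine ⟨fun t => sSup (insert 0 {s ∈ Ioo 0 D | φ s ≤ t}), fun t => ⟨?_, ?_⟩, ?_, ?_⟩
  · exact le_csSup (hbdd t) (mem_insert _ _)
  · refine csSup_le (insert_nonempty _ _) ?_
    rintro s (rfl | hs)
    exacts [hD.le, hs.1.2.le]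
  · exact fun s hs t ht => le_csSup (hbdd t) (mem_insert_of_mem _ ⟨hs, ht⟩)
  · intro s hs t hst
    obtain ⟨u, hu, hsu⟩ := exists_lt_of_lt_csSup (insert_nonempty _ _) hst
    rcases hu with rfl | hu
    · exact absurd hsu hs.1.not_gt
    · exact (hφ hs hu.1 hsu.le).trans hu.2

variable {X : Type*} [MetricSpace X] {K : X → ℝ} {γ : ℝ → X}

/-- A curve that is `1`-Lipschitz for the chain distance is controlled by the primitive of
`1 / K ^ 2` along it. -/
theorem ChainDistLE.dist_le_integral_inv_sq [TopologicalSpace.SeparableSpace X]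
    (hKc : Continuous K) (hK : ∀ x, 0 ≤ K x)
    (hγ : ∀ s s', s ≤ s' → ChainDistLE K (γ s) (γ s') (s' - s)) (hγc : Continuous γ) {a b C : ℝ}
    (hab : a ≤ b) (hpos : ∀ s ∈ Icc a b, 0 < K (γ s)) (hC : ∀ s ∈ Icc a b, K (γ s) ≤ C) :
    dist (γ a) (γ b) ≤ C * ∫ s in a..b, (K (γ s) ^ 2)⁻¹ := by
  have hC0 : 0 ≤ C := (hK _).trans (hC a (left_mem_Icc.2 hab))
  obtain ⟨L, hL⟩ := (locallyLipschitzOnSet hKc hK hγ hγc hpos).exists_lipschitzOnWith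
    isCompact_Icc
  have hcont : ContinuousOn (fun s => C * (K (γ s) ^ 2)⁻¹) (Icc a b) :=
    continuousOn_const.mul ((((hKc.comp hγc).pow 2).continuousOn).inv₀
      fun s hs => (pow_pos (hpos s hs) 2).ne')
  have hInt : IntegrableOn (fun s => C * (K (γ s) ^ 2)⁻¹) (Ioo a b) :=
    (hcont.integrableOn_compact isCompact_Icc).mono_set Ioo_subset_Icc_self
  have hnn : ∀ s, 0 ≤ C * (K (γ s) ^ 2)⁻¹ := fun s => by positivity
  rw [← intervalIntegral.integral_const_mul, intervalIntegral.integral_of_le hab,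
    integral_Ioc_eq_integral_Ioo, ← ENNReal.ofReal_le_ofReal_iff (integral_nonneg hnn),
    ofReal_integral_eq_lintegral_ofReal hInt (ae_of_all _ hnn)]
  refine (hL.ofReal_dist_le_lintegral_metricDeriv hab).trans
    (setLIntegral_mono' measurableSet_Ioo fun s hs => ENNReal.ofReal_le_ofReal ?_)
  have hs' := Ioo_subset_Icc_self hs
  have hp := hpos s hs'
  have h1 := mul_metricDerivWithin_le_one hKc hK hγ hγc s
  rw [← div_eq_mul_inv, le_div_iff₀ (by positivity)]
  calc metricDerivWithin γ univ s * K (γ s) ^ 2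
      = K (γ s) * (K (γ s) * metricDerivWithin γ univ s) := by ring
    _ ≤ K (γ s) * 1 := mul_le_mul_of_nonneg_left h1 hp.le
    _ ≤ C := by rw [mul_one]; exact hC s hs'

/-- A geodesic that avoids the zeros of `K` except at its ends can be reparametrised over `ℝ`
with speed at most `K`, and the resulting curve has energy at most the length of the geodesic. -/
theorem exists_equipartition_reparametrization [TopologicalSpace.SeparableSpace X]
    (hKc : Continuous K) (hK : ∀ x, 0 ≤ K x)
    (hγ : ∀ s s', s ≤ s' → ChainDistLE K (γ s) (γ s') (s' - s)) (hγc : Continuous γ) {D : ℝ}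
    (hD : 0 < D) (h0 : K (γ 0) = 0) (h1 : K (γ D) = 0) (hne : ∀ s ∈ Ioo 0 D, K (γ s) ≠ 0) :
    ∃ σ : ℝ → X, (∃ C : ℝ≥0, LipschitzWith C σ) ∧ Tendsto σ atBot (𝓝 (γ 0)) ∧
      Tendsto σ atTop (𝓝 (γ D)) ∧
      energyW (fun x => K x ^ 2 / 2) σ univ ≤ ENNReal.ofReal D := by
  have hpos : ∀ s ∈ Ioo 0 D, 0 < K (γ s) := fun s hs => (hK _).lt_of_ne' (hne s hs)
  have hκc : Continuous fun s => K (γ s) := hKc.comp hγc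
  set φ : ℝ → ℝ := fun s => ∫ u in (D / 2)..s, (K (γ u) ^ 2)⁻¹ with hφdef
  have hcontOn : ContinuousOn (fun s => (K (γ s) ^ 2)⁻¹) (Ioo 0 D) :=
    ((hκc.pow 2).continuousOn).inv₀ fun s hs => (pow_pos (hpos s hs) 2).ne'
  have hmid : D / 2 ∈ Ioo 0 D := ⟨by linarith, by linarith⟩
  have hii : ∀ a ∈ Ioo 0 D, ∀ b ∈ Ioo 0 D,
      IntervalIntegrable (fun s => (K (γ s) ^ 2)⁻¹) volume a b := fun a ha b hb =>
    (hcontOn.mono (ordConnected_Ioo.uIcc_subset ha hb)).intervalIntegrable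
  have hφd : ∀ s ∈ Ioo 0 D, HasDerivAt φ (K (γ s) ^ 2)⁻¹ s := fun s hs =>
    intervalIntegral.integral_hasDerivAt_right (hii _ hmid s hs)
      (hcontOn.stronglyMeasurableAtFilter isOpen_Ioo s hs)
      (hcontOn.continuousAt (isOpen_Ioo.mem_nhds hs))
  have hφsub : ∀ a ∈ Ioo 0 D, ∀ b ∈ Ioo 0 D, φ b - φ a = ∫ s in a..b, (K (γ s) ^ 2)⁻¹ :=
    fun a ha b hb => intervalIntegral.integral_interval_sub_left (hii _ hmid b hb) (hii _ hmid a ha)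
  have hφmono : StrictMonoOn φ (Ioo 0 D) := by
    refine strictMonoOn_of_deriv_pos (convex_Ioo 0 D)
      (fun s hs => (hφd s hs).continuousAt.continuousWithinAt) fun s hs => ?_
    rw [interior_Ioo] at hs
    rw [(hφd s hs).deriv]
    exact inv_pos.2 (pow_pos (hpos s hs) 2)
  obtain ⟨ψ, hψI, hψle, hψlt⟩ := hφmono.monotoneOn.exists_generalized_inverse hD
  have hψmono : Monotone ψ := by
    intro t t' htt'
    by_contra! h
    obtain ⟨s, hs, hs'⟩ := exists_between h
    have hsI : s ∈ Ioo 0 D := ⟨(hψI t').1.trans_lt hs, hs'.trans_le (hψI t).2⟩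
    exact hs.not_ge (hψle s hsI t' ((hψlt s hsI t hs').trans htt'))
  have hψφ : ∀ s ∈ Ioo 0 D, ψ (φ s) = s := by
    intro s hs
    refine le_antisymm ?_ (hψle s hs _ le_rfl)
    by_contra! h
    obtain ⟨u, hu, hu'⟩ := exists_between h
    have huI : u ∈ Ioo 0 D := ⟨hs.1.trans hu, hu'.trans_le (hψI _).2⟩
    exact (hφmono hs huI hu).not_ge (hψlt u huI _ hu')
  have hψmem : ∀ t, ψ t ∈ Ioo 0 D → t = φ (ψ t) := by
    intro t ht
    have hct := (hφd _ ht).continuousAt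
    refine le_antisymm ?_ ?_
    · refine ge_of_tendsto (hct.tendsto.mono_left nhdsWithin_le_nhds : Tendsto φ (𝓝[>] ψ t) _) ?_
      filter_upwards [Ioo_mem_nhdsGT ht.2] with u hu
      by_contra! h
      exact hu.1.not_ge (hψle u ⟨ht.1.trans hu.1, hu.2⟩ t h.le)
    · refine le_of_tendsto (hct.tendsto.mono_left nhdsWithin_le_nhds : Tendsto φ (𝓝[<] ψ t) _) ?_
      filter_upwards [Ioo_mem_nhdsLT ht.1] with u hu
      exact hψlt u ⟨hu.1, hu.2.trans ht.2⟩ t hu.2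
  have hdist : ∀ t t' C, t ≤ t' → 0 ≤ C → (∀ s ∈ Ioo (ψ t) (ψ t'), K (γ s) ≤ C) →
      dist (γ (ψ t)) (γ (ψ t')) ≤ C * (t' - t) := by
    intro t t' C htt' hC0 hC
    rcases (hψmono htt').eq_or_lt with heq | hlt
    · rw [heq, dist_self]
      exact mul_nonneg hC0 (by linarith)
    have hin : ∀ s ∈ Ioo (ψ t) (ψ t'), s ∈ Ioo 0 D := fun s hs =>
      ⟨(hψI t).1.trans_lt hs.1, hs.2.trans_le (hψI t').2⟩
    have hstep : ∀ s₁ ∈ Ioo (ψ t) (ψ t'), ∀ s₂ ∈ Ioo s₁ (ψ t'),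
        dist (γ s₁) (γ s₂) ≤ C * (t' - t) := by
      intro s₁ hs₁ s₂ hs₂
      have hs₂' : s₂ ∈ Ioo (ψ t) (ψ t') := ⟨hs₁.1.trans hs₂.1, hs₂.2⟩
      have hsub : Icc s₁ s₂ ⊆ Ioo (ψ t) (ψ t') := fun s hs =>
        ⟨hs₁.1.trans_le hs.1, hs.2.trans_lt hs₂.2⟩
      have := ChainDistLE.dist_le_integral_inv_sq hKc hK hγ hγc hs₂.1.le
        (fun s hs => hpos s (hin s (hsub hs))) (fun s hs => hC s (hsub hs))
      rw [← hφsub _ (hin _ hs₁) _ (hin _ hs₂')] at this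
      refine this.trans (mul_le_mul_of_nonneg_left (sub_le_sub ?_ ?_) hC0)
      · exact hψlt _ (hin _ hs₂') _ hs₂.2
      · by_contra! h
        exact hs₁.1.not_ge (hψle _ (hin _ hs₁) _ h.le)
    have hstep' : ∀ s₁ ∈ Ioo (ψ t) (ψ t'), dist (γ s₁) (γ (ψ t')) ≤ C * (t' - t) := by
      intro s₁ hs₁
      refine le_of_tendsto (((continuous_const.dist hγc).tendsto (ψ t')).mono_left
        (nhdsWithin_le_nhds (s := Iio (ψ t')))) ?_
      filter_upwards [Ioo_mem_nhdsLT hs₁.2] with s₂ hs₂ using hstep s₁ hs₁ s₂ hs₂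
    refine le_of_tendsto (((hγc.dist continuous_const).tendsto (ψ t)).mono_left
      (nhdsWithin_le_nhds (s := Ioi (ψ t)))) ?_
    filter_upwards [Ioo_mem_nhdsGT hlt] with s₁ hs₁ using hstep' s₁ hs₁
  have hcases : ∀ t, ψ t ∈ Ioo 0 D ∨ ψ t = 0 ∨ ψ t = D := by
    intro t
    rcases (hψI t).1.eq_or_lt with h | h
    · exact .inr (.inl h.symm)
    rcases (hψI t).2.eq_or_lt with h' | h'
    · exact .inr (.inr h')
    · exact .inl ⟨h, h'⟩
  have hspeed : ∀ t, metricDerivWithin (fun t => γ (ψ t)) univ t ≤ K (γ (ψ t)) := by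
    intro t
    rcases hcases t with ht | ht | ht
    · refine le_of_forall_gt_imp_ge_of_dense fun C hC => ?_
      refine metricDerivWithin_univ_le ((hK _).trans hC.le) ?_
      obtain ⟨δ, hδ, hball⟩ := Metric.mem_nhds_iff.1
        ((hκc.tendsto (ψ t)).eventually (gt_mem_nhds hC))
      obtain ⟨s', hs'⟩ := exists_between (show ψ t < min D (ψ t + δ) from lt_min ht.2 (by linarith))
      have hs'D := hs'.2.trans_le (min_le_left _ _)
      have hs'δ := hs'.2.trans_le (min_le_right _ _)
      have hs'I : s' ∈ Ioo 0 D := ⟨ht.1.trans hs'.1, hs'D⟩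
      have htφ : t < φ s' := by
        by_contra! h
        exact hs'.1.not_ge (hψle s' hs'I t h)
      have hev : ∀ᶠ u in 𝓝[>] t, dist (γ (ψ u)) (γ (ψ t)) ≤ C * |u - t| := by
        filter_upwards [Ioo_mem_nhdsGT htφ] with u hu
        have hψu : ψ u ≤ s' := by
          by_contra! h
          exact hu.2.not_ge (hψlt s' hs'I u h)
        rw [dist_comm, abs_of_pos (sub_pos.2 hu.1)]
        refine hdist t u C hu.1.le ((hK _).trans hC.le) fun s hs => le_of_lt (hball ?_)
        rw [Metric.mem_ball, Real.dist_eq, abs_lt]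
        constructor <;> linarith [hs.1, hs.2]
      exact hev.frequently.filter_mono (nhdsWithin_mono t fun u hu => (mem_Ioi.1 hu).ne')
    · rw [ht, h0]
      refine metricDerivWithin_univ_le le_rfl ?_
      have hev : ∀ᶠ u in 𝓝[<] t, dist (γ (ψ u)) (γ (ψ t)) ≤ 0 * |u - t| := by
        filter_upwards [self_mem_nhdsWithin] with u hu
        have : ψ u = ψ t := le_antisymm (hψmono (mem_Iio.1 hu).le) (ht ▸ (hψI u).1)
        simp [this]
      exact hev.frequently.filter_mono (nhdsWithin_mono t fun u hu => (mem_Iio.1 hu).ne)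
    · rw [ht, h1]
      refine metricDerivWithin_univ_le le_rfl ?_
      have hev : ∀ᶠ u in 𝓝[>] t, dist (γ (ψ u)) (γ (ψ t)) ≤ 0 * |u - t| := by
        filter_upwards [self_mem_nhdsWithin] with u hu
        have : ψ u = ψ t := le_antisymm (ht ▸ (hψI u).2) (hψmono (mem_Ioi.1 hu).le)
        simp [this]
      exact hev.frequently.filter_mono (nhdsWithin_mono t fun u hu => (mem_Ioi.1 hu).ne')
  refine ⟨fun t => γ (ψ t), ?_, ?_, ?_, ?_⟩
  · obtain ⟨C, hC⟩ := (isCompact_Icc (a := 0) (b := D)).bddAbove_image hκc.continuousOn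
    have hC' : ∀ s ∈ Icc 0 D, K (γ s) ≤ C := fun s hs => hC ⟨s, hs, rfl⟩
    have hC0 : 0 ≤ C := (hK _).trans (hC' 0 (left_mem_Icc.2 hD.le))
    have hle : ∀ t t', t ≤ t' → dist (γ (ψ t)) (γ (ψ t')) ≤ C * (t' - t) := fun t t' h =>
      hdist t t' C h hC0 fun s hs =>
        hC' s ⟨(hψI t).1.trans hs.1.le, hs.2.le.trans (hψI t').2⟩
    refine ⟨C.toNNReal, LipschitzWith.of_dist_le_mul fun t t' => ?_⟩
    rw [Real.coe_toNNReal _ hC0, Real.dist_eq]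
    rcases le_total t t' with h | h
    · rw [abs_sub_comm, abs_of_nonneg (sub_nonneg.2 h)]
      exact hle t t' h
    · rw [dist_comm, abs_of_nonneg (sub_nonneg.2 h)]
      exact hle t' t h
  · refine (hγc.tendsto 0).comp (tendsto_order.2 ⟨fun a ha => ?_, fun b hb => ?_⟩)
    · exact Eventually.of_forall fun t => ha.trans_le (hψI t).1
    · obtain ⟨s, hs⟩ := exists_between (lt_min hb hD)
      have hsI : s ∈ Ioo 0 D := ⟨hs.1, hs.2.trans_le (min_le_right _ _)⟩
      filter_upwards [eventually_lt_atBot (φ s)] with t ht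
      refine lt_of_le_of_lt ?_ (hs.2.trans_le (min_le_left _ _))
      by_contra! h
      exact ht.not_ge (hψlt s hsI t h)
  · refine (hγc.tendsto D).comp (tendsto_order.2 ⟨fun a ha => ?_, fun b hb => ?_⟩)
    · obtain ⟨s, hs⟩ := exists_between (max_lt ha hD)
      have hsI : s ∈ Ioo 0 D := ⟨(le_max_right _ _).trans_lt hs.1, hs.2⟩
      filter_upwards [eventually_ge_atTop (φ s)] with t ht
      exact ((le_max_left _ _).trans_lt hs.1).trans_le (hψle s hsI t ht)
    · exact Eventually.of_forall fun t => (hψI t).2.trans_lt hb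
  · calc energyW (fun x => K x ^ 2 / 2) (fun t => γ (ψ t)) univ
        ≤ ∫⁻ t, ENNReal.ofReal (K (γ (ψ t)) ^ 2) := by
          rw [energyW, Measure.restrict_univ]
          refine lintegral_mono fun t => ENNReal.ofReal_le_ofReal ?_
          have := pow_le_pow_left₀ (metricDerivWithin_univ_nonneg (fun t => γ (ψ t)) t)
            (hspeed t) 2
          linarith
      _ = ∫⁻ t in φ '' Ioo 0 D, ENNReal.ofReal (K (γ (ψ t)) ^ 2) := by
          refine (setLIntegral_eq_of_support_subset fun t ht => ?_).symm
          rcases hcases t with h | h | h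
          · exact ⟨ψ t, h, (hψmem t h).symm⟩
          · exact absurd (by simp [h, h0]) ht
          · exact absurd (by simp [h, h1]) ht
      _ = ∫⁻ s in Ioo 0 D, ENNReal.ofReal |(K (γ s) ^ 2)⁻¹| *
            ENNReal.ofReal (K (γ (ψ (φ s))) ^ 2) :=
          lintegral_image_eq_lintegral_abs_deriv_mul measurableSet_Ioo
            (fun s hs => (hφd s hs).hasDerivWithinAt) hφmono.injOn _
      _ = ∫⁻ _ in Ioo 0 D, 1 := by
          refine setLIntegral_congr_fun measurableSet_Ioo fun s hs => ?_
          have hp := pow_pos (hpos s hs) 2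
          simp only [hψφ s hs]
          rw [← ENNReal.ofReal_mul (abs_nonneg _), abs_of_pos (inv_pos.2 hp),
            inv_mul_cancel₀ hp.ne', ENNReal.ofReal_one]
      _ = ENNReal.ofReal D := by simp

end TimeChange

section Energy

variable {X : Type*} [MetricSpace X]

theorem dK_le_energyW {W : X → ℝ} (hW0 : ∀ x, 0 ≤ W x) {σ : ℝ → X} {x y : X}
    (hσ : PiecewiseLocLipOn σ univ) (hx : Tendsto σ atBot (𝓝 x)) (hy : Tendsto σ atTop (𝓝 y)) :
    dK (fun z => √(2 * W z)) x y ≤ energyW W σ univ := by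
  have hpath : IsPathOn σ univ x y := by
    refine ⟨univ_nonempty, ordConnected_univ, hσ.1, ?_, ?_⟩
    · rwa [leftEndFilter, if_neg not_bddBelow_univ, principal_univ, inf_top_eq]
    · rwa [rightEndFilter, if_neg not_bddAbove_univ, principal_univ, inf_top_eq]
  refine iInf₂_le_of_le σ univ (iInf₂_le_of_le hσ hpath ?_)
  refine lintegral_mono fun t => ENNReal.ofReal_le_ofReal ?_
  have hsq := Real.sq_sqrt (show 0 ≤ 2 * W (σ t) by linarith [hW0 (σ t)])
  nlinarith [sq_nonneg (√(2 * W (σ t)) - metricDerivWithin σ univ t)]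

theorem LipschitzWith.piecewiseLocLipOn {C : ℝ≥0} {σ : ℝ → X} (h : LipschitzWith C σ) :
    PiecewiseLocLipOn σ univ :=
  ⟨h.continuous.continuousOn, ∅, fun _ _ => ⟨1, one_pos, C, h.lipschitzOnWith⟩⟩

end Energy

/-- existence of heteroclinic connections in a metric space. Under (H) (i.e.
(H1)-(H3) for `K = √(2W)`) and the strict triangle inequality (STI), there is a Lipschitz
curve `γ : ℝ → X` from `x⁻` to `x⁺` minimizing `E_W` among piecewise locally Lipschitz
connections, with `E_W(γ) = d_K(x⁻, x⁺)`. -/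
theorem exists_heteroclinic_connection
    {X : Type*} [MetricSpace X] [ProperSpace X] (hlen : IsLengthSpace X)
    (W : X → ℝ) (hWc : Continuous W) (hW0 : ∀ x, 0 ≤ W x)
    (hfin : {x : X | W x = 0}.Finite)
    (k : ℝ → ℝ) (hkc : ContinuousOn k (Set.Ici 0)) (hk0 : ∀ t ∈ Set.Ici (0 : ℝ), 0 ≤ k t)
    (hkdiv : ∫⁻ t in Set.Ioi (0 : ℝ), ENNReal.ofReal (k t) = ⊤)
    (hlow : ∀ x : X, k (Metric.infDist x {x : X | W x = 0}) ≤ Real.sqrt (2 * W x))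
    (xm xp : X) (hxm : W xm = 0) (hxp : W xp = 0)
    (hSTI : ∀ x : X, W x = 0 → x ≠ xm → x ≠ xp →
      dK (fun z => Real.sqrt (2 * W z)) xm xp <
        dK (fun z => Real.sqrt (2 * W z)) xm x + dK (fun z => Real.sqrt (2 * W z)) x xp) :
    ∃ γ : ℝ → X, (∃ C : NNReal, LipschitzWith C γ) ∧
      Tendsto γ atBot (𝓝 xm) ∧ Tendsto γ atTop (𝓝 xp) ∧
      energyW W γ Set.univ =
        (⨅ (σ : ℝ → X) (_ : PiecewiseLocLipOn σ Set.univ)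
          (_ : Tendsto σ atBot (𝓝 xm)) (_ : Tendsto σ atTop (𝓝 xp)),
            energyW W σ Set.univ) ∧
      energyW W γ Set.univ = dK (fun z => Real.sqrt (2 * W z)) xm xp := by
  set K : X → ℝ := fun z => √(2 * W z) with hKdef
  have hKc : Continuous K := (continuous_const.mul hWc).sqrt
  have hK : ∀ x, 0 ≤ K x := fun x => Real.sqrt_nonneg _
  have hK0 : ∀ x, K x = 0 ↔ W x = 0 := fun x => by
    simp only [hKdef]
    rw [Real.sqrt_eq_zero (by linarith [hW0 x])]
    simp
  have hset : {x | K x = 0} = {x | W x = 0} := by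
    ext x
    exact hK0 x
  have hWK : (fun x => K x ^ 2 / 2) = W := by
    ext x
    simp only [hKdef]
    rw [Real.sq_sqrt (by linarith [hW0 x])]
    ring
  have hR : ∀ B, ∃ ε₀ > 0, ∃ R, ∀ z c, c ≤ B → ChainCost K ε₀ xm z c → dist xm z ≤ R := by
    refine exists_dist_le_of_chainCost (k := fun t => k |t|) (S := {x | W x = 0})
      (hkc.comp_continuous continuous_abs abs_nonneg) (fun t => hk0 _ (abs_nonneg t)) ?_ hfin
      (fun x => ?_) hxm
    · rw [← hkdiv]
      refine setLIntegral_congr_fun measurableSet_Ioi fun t ht => ?_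
      simp only [abs_of_pos (mem_Ioi.1 ht)]
    · simp only [abs_of_nonneg Metric.infDist_nonneg]
      exact hlow x
  obtain ⟨D, hD0, hDle, γ, hγc, hγ, hγx, hγy, hne⟩ := exists_geodesic_avoiding_zeros hlen hKc hK
    (hset ▸ hfin) (x := xm) (y := xp) hR fun z hz => hSTI z ((hK0 z).1 hz)
  obtain ⟨σ, ⟨C, hσ⟩, hσm, hσp, hσE⟩ : ∃ σ : ℝ → X, (∃ C : ℝ≥0, LipschitzWith C σ) ∧
      Tendsto σ atBot (𝓝 xm) ∧ Tendsto σ atTop (𝓝 xp) ∧ energyW W σ univ ≤ ENNReal.ofReal D := by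
    rcases hD0.eq_or_lt with hD | hD
    · have hxx : xm = xp := (hγx 0 le_rfl).symm.trans (hγy 0 hD.ge)
      refine ⟨fun _ => xm, ⟨0, LipschitzWith.const xm⟩, tendsto_const_nhds,
        hxx ▸ tendsto_const_nhds, ?_⟩
      have hmd : ∀ t, metricDerivWithin (fun _ : ℝ => xm) univ t = 0 := fun t =>
        le_antisymm
          (metricDerivWithin_univ_le le_rfl (Eventually.of_forall fun s => by simp).frequently)
          (metricDerivWithin_univ_nonneg _ t)
      simp [energyW, hmd, hxm]
    · have := exists_equipartition_reparametrization hKc hK hγ hγc hD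
        (by rw [hγx 0 le_rfl]; exact (hK0 _).2 hxm) (by rw [hγy D le_rfl]; exact (hK0 _).2 hxp) hne
      rwa [hWK, hγx 0 le_rfl, hγy D le_rfl] at this
  have hlower : dK K xm xp ≤ ⨅ (σ : ℝ → X) (_ : PiecewiseLocLipOn σ Set.univ)
      (_ : Tendsto σ atBot (𝓝 xm)) (_ : Tendsto σ atTop (𝓝 xp)), energyW W σ Set.univ :=
    le_iInf₂ fun σ hσ => le_iInf₂ fun hm hp => dK_le_energyW hW0 hσ hm hp
  have hupper := hσE.trans hDle
  have hinf : (⨅ (σ : ℝ → X) (_ : PiecewiseLocLipOn σ Set.univ)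
      (_ : Tendsto σ atBot (𝓝 xm)) (_ : Tendsto σ atTop (𝓝 xp)), energyW W σ Set.univ) ≤
      energyW W σ Set.univ :=
    iInf₂_le_of_le σ hσ.piecewiseLocLipOn (iInf₂_le_of_le hσm hσp le_rfl)
  exact ⟨σ, ⟨C, hσ⟩, hσm, hσp, le_antisymm (hupper.trans hlower) hinf,
    le_antisymm hupper (hlower.trans hinf)⟩
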